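/- Let B be a finitely accessible additive category. Then the following are equivalent: (1) K(B) is well generated; (2) K(B) is ℵ₁-well generated; (3) B is pure semisimple. If moreover B has products, these are further equivalent to: (4) K(B) is compactly generated. -/

import Mathlib

namespace LocWellGen

open CategoryTheory CategoryTheory.Limits CategoryTheory.Pretriangulated ZeroObject

universe v u

variable (T : Type u) [Category.{v} T] [HasZeroObject T] [HasShift T ℤ]
  [Preadditive T] [∀ n : ℤ, (shiftFunctor T n).Additive] [Pretriangulated T]

/-- A localizing subcategory of a pretriangulated category, given as a class of objects:
a full triangulated subcategory closed under isomorphisms and (existing) coproducts. -/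
structure IsLocalizing (L : Set T) : Prop where
  zero : (0 : T) ∈ L
  isoClosed : ∀ {X Y : T}, (X ≅ Y) → X ∈ L → Y ∈ L
  shiftClosed : ∀ (X : T) (n : ℤ), X ∈ L → X⟦n⟧ ∈ L
  ext₂ : ∀ D ∈ distTriang T, D.obj₁ ∈ L → D.obj₃ ∈ L → D.obj₂ ∈ L
  coproductClosed : ∀ {I : Type v} (X : I → T), (∀ i, X i ∈ L) →
    ∀ (c : Cofan X), IsColimit c → c.pt ∈ L

/-- `Loc S` : the smallest localizing subcategory containing `S`. -/
def Loc (S : Set T) : Set T := ⋂₀ {L : Set T | IsLocalizing T L ∧ S ⊆ L}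

/-- `Y` is `κ`-small: any morphism from `Y` to a coproduct (of objects of `L`) factors
through a subcoproduct with fewer than `κ` summands. -/
def IsKappaSmall (L : Set T) (κ : Cardinal.{v}) (Y : T) : Prop :=
  ∀ {I : Type v} (X : I → T), (∀ i, X i ∈ L) →
    ∀ (c : Cofan X), IsColimit c → ∀ f : Y ⟶ c.pt,
      ∃ (J : Set I) (c' : Cofan fun j : J => X j) (hc' : IsColimit c') (g : Y ⟶ c'.pt),
        Cardinal.mk J < κ ∧
        f = g ≫ hc'.desc (Cofan.mk c.pt fun j : J => c.inj j.1)

/-- Condition (3) of well generation: every morphism from `Y` to a coproduct of a family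
in `L` factors through a coproduct of objects of `S` via a coproduct of morphisms. -/
def FactorsThroughFamily (L S : Set T) (Y : T) : Prop :=
  ∀ {I : Type v} (X : I → T), (∀ i, X i ∈ L) →
    ∀ (c : Cofan X), IsColimit c → ∀ f : Y ⟶ c.pt,
      ∃ (Z : I → T) (_ : ∀ i, Z i ∈ S) (φ : ∀ i, Z i ⟶ X i)
        (cz : Cofan Z) (hcz : IsColimit cz) (g : Y ⟶ cz.pt),
        f = g ≫ hcz.desc (Cofan.mk c.pt fun i => φ i ≫ c.inj i)

/-- The set `S` witnesses that the (localizing sub)category `L` is `κ`-well generated. -/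
structure GeneratesWell (L : Set T) (κ : Cardinal.{v}) (S : Set T) : Prop where
  subset : S ⊆ L
  isSmall : Small.{v} ↥S
  nondegenerate : ∀ X ∈ L, (∀ Y ∈ S, ∀ f : Y ⟶ X, f = 0) → IsZero X
  kappaSmall : ∀ Y ∈ S, IsKappaSmall T L κ Y
  factors : ∀ Y ∈ S, FactorsThroughFamily T L S Y

/-- `L` is a `κ`-well generated (localizing sub)category. -/
def IsWellGeneratedOfCard (L : Set T) (κ : Cardinal.{v}) : Prop :=
  κ.IsRegular ∧ ∃ S : Set T, GeneratesWell T L κ S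

/-- `L` is a well generated (localizing sub)category. -/
def IsWellGeneratedSubcat (L : Set T) : Prop :=
  ∃ κ : Cardinal.{v}, IsWellGeneratedOfCard T L κ

/-- compactly generated = `ℵ₀`-well generated -/
def IsCompactlyGeneratedSubcat (L : Set T) : Prop :=
  IsWellGeneratedOfCard T L Cardinal.aleph0

/-- The whole category `T` is well generated. -/
abbrev IsWellGenerated : Prop := IsWellGeneratedSubcat T Set.univ

/-- A localizing subcategory `L` is locally well generated if the localizing subcategory
generated by any set of its objects is well generated. -/
def IsLocallyWellGeneratedSubcat (L : Set T) : Prop :=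
  ∀ S : Set T, S ⊆ L → Small.{v} ↥S → IsWellGeneratedSubcat T (Loc T S)

/-- `T` is locally well generated. -/
abbrev IsLocallyWellGenerated : Prop := IsLocallyWellGeneratedSubcat T Set.univ

/-- `Y` is a retract (direct summand) of `X`. -/
def IsRetractOf {B : Type*} [Category B] (Y X : B) : Prop :=
  ∃ (s : Y ⟶ X) (r : X ⟶ Y), s ≫ r = 𝟙 Y

end LocWellGen

namespace LocWellGen

open CategoryTheory CategoryTheory.Limits

universe v u
/-- An additive category with arbitrary coproducts is pure semisimple if it has an
additive generator: `B = Add X` for some `X`, i.e. every object is a direct summand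
of a coproduct of copies of `X`. -/
def IsPureSemisimple (B : Type u) [Category.{v} B] : Prop :=
  ∃ X : B, ∀ Y : B, ∃ (I : Type v) (c : Cofan fun _ : I => X) (_ : IsColimit c),
    IsRetractOf Y c.pt

end LocWellGen

namespace LocWellGen


open CategoryTheory CategoryTheory.Limits

universe v u

/-- An object `X` is finitely presentable if `Hom(X,-)` preserves filtered colimits. -/
def IsFinitelyPresentable (B : Type u) [Category.{v} B] (X : B) : Prop :=
  ∀ (J : Type v) (cJ : SmallCategory J),
    (by exact IsFiltered J →
      Nonempty (PreservesColimitsOfShape J (coyoneda.obj (Opposite.op X))) : Prop)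

/-- A presentation of `X` as a colimit of a filtered diagram. -/
structure FilteredColimitPresentation (B : Type u) [Category.{v} B] (X : B) where
  /-- the index category -/
  J : Type v
  [cat : SmallCategory J]
  [filtered : IsFiltered J]
  /-- the diagram -/
  D : J ⥤ B
  /-- a cocone on the diagram -/
  c : Cocone D
  /-- which is a colimit cocone -/
  hc : IsColimit c
  /-- whose point is isomorphic to `X` -/
  iso : c.pt ≅ X

attribute [instance] FilteredColimitPresentation.cat FilteredColimitPresentation.filtered

/-- `B` is finitely accessible: it has filtered colimits and there is a set of finitely
presentable objects such that every object is a filtered colimit of objects of this set. -/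
def IsFinitelyAccessible (B : Type u) [Category.{v} B] : Prop :=
  (∀ (J : Type v) (cJ : SmallCategory J),
    (by exact IsFiltered J → HasColimitsOfShape J B : Prop)) ∧
  ∃ (ι : Type v) (G : ι → B), (∀ i, IsFinitelyPresentable B (G i)) ∧
    ∀ X : B, ∃ p : FilteredColimitPresentation B X, ∀ j, p.D.obj j ∈ Set.range G
section CofanDesc

variable {C : Type*} [Category* C] {I : Type*} {X : I → C} {c : Cofan X} (hc : IsColimit c)

include hc in
lemma cofan_hom_ext {W : C} {f g : c.pt ⟶ W} (h : ∀ i, c.inj i ≫ f = c.inj i ≫ g) : f = g :=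
  Cofan.IsColimit.hom_ext hc f g h

/-- The morphism out of a coproduct with given components. -/
def cofanDesc {W : C} (f : ∀ i, X i ⟶ W) : c.pt ⟶ W := hc.desc (Cofan.mk W f)

@[simp]
lemma inj_cofanDesc {W : C} (f : ∀ i, X i ⟶ W) (i : I) : c.inj i ≫ cofanDesc hc f = f i :=
  hc.fac (Cofan.mk W f) ⟨i⟩

@[simp]
lemma inj_cofanDesc_assoc {W W' : C} (f : ∀ i, X i ⟶ W) (i : I) (g : W ⟶ W') :
    c.inj i ≫ cofanDesc hc f ≫ g = f i ≫ g := by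
  rw [← Category.assoc, inj_cofanDesc]

end CofanDesc

section CofanProjections

variable {C : Type*} [Category* C] [Preadditive C] {I : Type*} {X : I → C} {c : Cofan X}
  (hc : IsColimit c)

open Classical in
/-- The idempotent endomorphism of a coproduct which projects onto the summands indexed by `U`. -/
noncomputable def cofanProj (U : Set I) : c.pt ⟶ c.pt :=
  cofanDesc hc fun i => if i ∈ U then c.inj i else 0

lemma inj_cofanProj_of_mem {U : Set I} {i : I} (hi : i ∈ U) :
    c.inj i ≫ cofanProj hc U = c.inj i := by
  simp [cofanProj, hi]

lemma inj_cofanProj_of_notMem {U : Set I} {i : I} (hi : i ∉ U) :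
    c.inj i ≫ cofanProj hc U = 0 := by
  simp [cofanProj, hi]

lemma inj_cofanProj_of_mem_assoc {U : Set I} {i : I} (hi : i ∈ U) {W : C} (f : c.pt ⟶ W) :
    c.inj i ≫ cofanProj hc U ≫ f = c.inj i ≫ f := by
  rw [← Category.assoc, inj_cofanProj_of_mem hc hi]

lemma inj_cofanProj_of_notMem_assoc {U : Set I} {i : I} (hi : i ∉ U) {W : C} (f : c.pt ⟶ W) :
    c.inj i ≫ cofanProj hc U ≫ f = 0 := by
  rw [← Category.assoc, inj_cofanProj_of_notMem hc hi, zero_comp]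

lemma cofanProj_comp (U V : Set I) :
    cofanProj hc U ≫ cofanProj hc V = cofanProj hc (U ∩ V) := by
  refine cofan_hom_ext hc fun i => ?_
  by_cases hU : i ∈ U <;> by_cases hV : i ∈ V <;> simp [cofanProj, hU, hV]

lemma cofanProj_comp_of_subset {U V : Set I} (h : U ⊆ V) :
    cofanProj hc U ≫ cofanProj hc V = cofanProj hc U := by
  rw [cofanProj_comp, Set.inter_eq_left.2 h]

@[simp]
lemma cofanProj_idem (U : Set I) : cofanProj hc U ≫ cofanProj hc U = cofanProj hc U :=
  cofanProj_comp_of_subset hc le_rfl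

@[simp]
lemma cofanProj_empty : cofanProj hc ∅ = 0 :=
  cofan_hom_ext hc fun i => by simp [cofanProj]

lemma supported_mono {W : C} {f : W ⟶ c.pt} {U V : Set I} (h : U ⊆ V)
    (hf : f ≫ cofanProj hc U = f) : f ≫ cofanProj hc V = f := by
  rw [← hf, Category.assoc, cofanProj_comp_of_subset hc h]

open Classical in
/-- The projection of a coproduct onto one of its summands. -/
noncomputable def cofanPi (i : I) : c.pt ⟶ X i :=
  cofanDesc hc fun j => if h : j = i then eqToHom (by rw [h]) else 0

@[simp]
lemma inj_cofanPi (i : I) : c.inj i ≫ cofanPi hc i = 𝟙 _ := by simp [cofanPi]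

@[simp]
lemma inj_cofanPi_assoc (i : I) {W : C} (f : X i ⟶ W) : c.inj i ≫ cofanPi hc i ≫ f = f := by
  rw [← Category.assoc, inj_cofanPi, Category.id_comp]

lemma inj_cofanPi_of_ne {i j : I} (h : j ≠ i) : c.inj j ≫ cofanPi hc i = 0 := by
  simp [cofanPi, h]

lemma inj_cofanPi_of_ne_assoc {i j : I} (h : j ≠ i) {W : C} (f : X i ⟶ W) :
    c.inj j ≫ cofanPi hc i ≫ f = 0 := by
  rw [← Category.assoc, inj_cofanPi_of_ne hc h, zero_comp]

lemma cofanProj_comp_cofanPi_of_notMem {U : Set I} {i : I} (hi : i ∉ U) :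
    cofanProj hc U ≫ cofanPi hc i = 0 := by
  refine cofan_hom_ext hc fun j => ?_
  by_cases hj : j ∈ U
  · have : j ≠ i := fun h => hi (h ▸ hj)
    rw [← Category.assoc, inj_cofanProj_of_mem hc hj, inj_cofanPi_of_ne hc this, comp_zero]
  · rw [← Category.assoc, inj_cofanProj_of_notMem hc hj, zero_comp, comp_zero]

lemma cofanProj_singleton (i : I) : cofanProj hc {i} = cofanPi hc i ≫ c.inj i := by
  refine cofan_hom_ext hc fun j => ?_
  by_cases hj : j = i
  · subst hj
    rw [inj_cofanProj_of_mem hc (Set.mem_singleton _), ← Category.assoc, inj_cofanPi,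
      Category.id_comp]
  · rw [inj_cofanProj_of_notMem hc (by simpa using hj), ← Category.assoc, inj_cofanPi_of_ne hc hj,
      zero_comp]

lemma cofanProj_union {U V : Set I} (h : Disjoint U V) :
    cofanProj hc (U ∪ V) = cofanProj hc U + cofanProj hc V := by
  refine cofan_hom_ext hc fun i => ?_
  by_cases hU : i ∈ U
  · have hV : i ∉ V := Set.disjoint_left.1 h hU
    simp [cofanProj, hU, hV]
  · by_cases hV : i ∈ V <;> simp [cofanProj, hU, hV]

end CofanProjections

section FinitelyPresentable

/-- The ordered set of natural numbers, as a category in an arbitrary universe. -/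
def uliftNatEquivalence : ULift.{v} ℕ ≌ ℕ :=
  OrderIso.equivalence ⟨Equiv.ulift, Iff.rfl⟩

variable {B : Type u} [Category.{v} B]

section

variable {a : B} (ha : IsFinitelyPresentable B a) {J : Type v} [SmallCategory J] [IsFiltered J]
  {D : J ⥤ B} {c : Cocone D} (hc : IsColimit c)

include ha hc

lemma IsFinitelyPresentable.exists_lift (x : a ⟶ c.pt) :
    ∃ (j : J) (y : a ⟶ D.obj j), y ≫ c.ι.app j = x := by
  obtain ⟨h⟩ := ha J inferInstance inferInstance
  obtain ⟨j, y, hy⟩ := Types.jointly_surjective_of_isColimit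
    (isColimitOfPreserves (coyoneda.obj (Opposite.op a)) hc) x
  exact ⟨j, y, hy⟩

lemma IsFinitelyPresentable.exists_eq {j : J} (y y' : a ⟶ D.obj j)
    (h : y ≫ c.ι.app j = y' ≫ c.ι.app j) :
    ∃ (k : J) (f : j ⟶ k), y ≫ D.map f = y' ≫ D.map f := by
  obtain ⟨hp⟩ := ha J inferInstance inferInstance
  obtain ⟨k, f, hf⟩ := (Types.FilteredColimit.isColimit_eq_iff'
    (isColimitOfPreserves (coyoneda.obj (Opposite.op a)) hc) y y').1 h
  exact ⟨k, f, hf⟩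

end

lemma IsFinitelyPresentable.preservesColimitsOfShape_nat {a : B} (ha : IsFinitelyPresentable B a) :
    Nonempty (PreservesColimitsOfShape ℕ (coyoneda.obj (Opposite.op a))) := by
  obtain ⟨h⟩ := ha (ULift.{v} ℕ) inferInstance inferInstance
  exact ⟨preservesColimitsOfShape_of_equiv
    (uliftNatEquivalence.{v}) _⟩

lemma IsFinitelyPresentable.exists_lift_nat {a : B} (ha : IsFinitelyPresentable B a) {D : ℕ ⥤ B}
    {c : Cocone D} (hc : IsColimit c) (x : a ⟶ c.pt) :
    ∃ (j : ℕ) (y : a ⟶ D.obj j), y ≫ c.ι.app j = x := by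
  obtain ⟨h⟩ := ha.preservesColimitsOfShape_nat
  obtain ⟨j, y, hy⟩ := Types.jointly_surjective_of_isColimit
    (isColimitOfPreserves (coyoneda.obj (Opposite.op a)) hc) x
  exact ⟨j, y, hy⟩

lemma IsFinitelyPresentable.exists_eq_nat {a : B} (ha : IsFinitelyPresentable B a) {D : ℕ ⥤ B}
    {c : Cocone D} (hc : IsColimit c) {j : ℕ} (y y' : a ⟶ D.obj j)
    (h : y ≫ c.ι.app j = y' ≫ c.ι.app j) :
    ∃ (k : ℕ) (f : j ⟶ k), y ≫ D.map f = y' ≫ D.map f := by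
  obtain ⟨hp⟩ := ha.preservesColimitsOfShape_nat
  obtain ⟨k, f, hf⟩ := (Types.FilteredColimit.isColimit_eq_iff'
    (isColimitOfPreserves (coyoneda.obj (Opposite.op a)) hc) y y').1 h
  exact ⟨k, f, hf⟩

lemma IsFinitelyPresentable.of_retract {a b : B} (hb : IsFinitelyPresentable B b)
    (s : a ⟶ b) (r : b ⟶ a) (h : s ≫ r = 𝟙 a) : IsFinitelyPresentable B a := by
  intro J _ _
  refine ⟨⟨fun {D} => ⟨fun {c} hc => ⟨?_⟩⟩⟩⟩
  refine Types.FilteredColimit.isColimitOf _ _ ?_ ?_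
  · intro x
    obtain ⟨j, y, hy⟩ := hb.exists_lift hc (r ≫ x)
    exact ⟨j, s ≫ y, by simp [hy, reassoc_of% h]⟩
  · intro i j y y' hyy
    obtain ⟨k, f, g, -⟩ : ∃ (k : J) (f : i ⟶ k) (g : j ⟶ k), True :=
      ⟨_, IsFiltered.leftToMax i j, IsFiltered.rightToMax i j, trivial⟩
    have hyy' : y ≫ c.ι.app i = y' ≫ c.ι.app j := hyy
    obtain ⟨l, t, ht⟩ := hb.exists_eq hc (r ≫ y ≫ D.map f) (r ≫ y' ≫ D.map g) (by
      simp [hyy'])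
    refine ⟨l, f ≫ t, g ≫ t, ?_⟩
    have := s ≫= ht
    simpa [reassoc_of% h] using this

lemma IsFinitelyPresentable.biprod [Preadditive B] [HasBinaryBiproducts B] {a b : B}
    (ha : IsFinitelyPresentable B a) (hb : IsFinitelyPresentable B b) :
    IsFinitelyPresentable B (a ⊞ b) := by
  intro J _ _
  refine ⟨⟨fun {D} => ⟨fun {c} hc => ⟨?_⟩⟩⟩⟩
  refine Types.FilteredColimit.isColimitOf _ _ ?_ ?_
  · intro x
    obtain ⟨j, y, hy⟩ := ha.exists_lift hc (biprod.inl ≫ x)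
    obtain ⟨j', y', hy'⟩ := hb.exists_lift hc (biprod.inr ≫ x)
    refine ⟨IsFiltered.max j j', biprod.desc (y ≫ D.map (IsFiltered.leftToMax j j'))
      (y' ≫ D.map (IsFiltered.rightToMax j j')), ?_⟩
    change x = _ ≫ c.ι.app _
    refine biprod.hom_ext' (x : a ⊞ b ⟶ c.pt) _ ?_ ?_ <;> simp [hy, hy']
  · intro i j y y' hyy
    have hyy' : y ≫ c.ι.app i = y' ≫ c.ι.app j := hyy
    obtain ⟨k, f, g, -⟩ : ∃ (k : J) (f : i ⟶ k) (g : j ⟶ k), True :=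
      ⟨_, IsFiltered.leftToMax i j, IsFiltered.rightToMax i j, trivial⟩
    obtain ⟨l, t, ht⟩ := ha.exists_eq hc (biprod.inl ≫ y ≫ D.map f) (biprod.inl ≫ y' ≫ D.map g)
      (by simp [hyy'])
    obtain ⟨l', t', ht'⟩ := hb.exists_eq hc (biprod.inr ≫ y ≫ D.map (f ≫ t))
      (biprod.inr ≫ y' ≫ D.map (g ≫ t)) (by simp [hyy'])
    refine ⟨l', f ≫ t ≫ t', g ≫ t ≫ t', ?_⟩
    change y ≫ _ = y' ≫ _
    refine biprod.hom_ext' (y ≫ _ : a ⊞ b ⟶ D.obj l') _ ?_ ?_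
    · simpa using ht =≫ D.map t'
    · simpa using ht'

lemma isFinitelyPresentable_of_isZero {a : B} (ha : IsZero a) :
    IsFinitelyPresentable B a := by
  intro J _ _
  refine ⟨⟨fun {D} => ⟨fun {c} hc => ⟨?_⟩⟩⟩⟩
  refine Types.FilteredColimit.isColimitOf _ _ ?_ ?_
  · intro x
    exact ⟨IsFiltered.nonempty.some, ha.to_ _, ha.eq_of_src _ _⟩
  · intro i j y y' hyy
    exact ⟨_, IsFiltered.leftToMax i j, IsFiltered.rightToMax i j, ha.eq_of_src _ _⟩

end FinitelyPresentable

section FinitelyAccessible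

variable {B : Type u} [Category.{v} B]

lemma IsFinitelyAccessible.hasFilteredColimits (hB : IsFinitelyAccessible B) :
    HasFilteredColimitsOfSize.{v, v} B :=
  ⟨fun J _ _ => hB.1 J inferInstance inferInstance⟩

lemma IsFinitelyAccessible.hasColimitsOfShape_nat (hB : IsFinitelyAccessible B) :
    HasColimitsOfShape ℕ B := by
  have := hB.hasFilteredColimits
  exact hasColimitsOfShape_of_equivalence
    (uliftNatEquivalence.{v})

/-- The transition morphisms of a sequence. -/
def seqTr {a : ℕ → B} (g : ∀ n, a n ⟶ a (n + 1)) {n m : ℕ} (h : n ≤ m) : a n ⟶ a m :=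
  (Functor.ofSequence g).map (homOfLE h)

@[simp]
lemma seqTr_refl {a : ℕ → B} (g : ∀ n, a n ⟶ a (n + 1)) {n : ℕ} (h : n ≤ n) :
    seqTr g h = 𝟙 _ := (Functor.ofSequence g).map_id n

lemma seqTr_comp {a : ℕ → B} (g : ∀ n, a n ⟶ a (n + 1)) {n m l : ℕ} (h : n ≤ m) (h' : m ≤ l) :
    seqTr g h ≫ seqTr g h' = seqTr g (h.trans h') :=
  ((Functor.ofSequence g).map_comp (homOfLE h) (homOfLE h')).symm

lemma seqTr_succ {a : ℕ → B} (g : ∀ n, a n ⟶ a (n + 1)) {n : ℕ} (h : n ≤ n + 1) :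
    seqTr g h = g n := Functor.ofSequence_map_homOfLE_succ g n

lemma seqTr_comp_of_comp {a : ℕ → B} {g : ∀ n, a n ⟶ a (n + 1)} {W : B} {f : ∀ n, a n ⟶ W}
    (hf : ∀ n, g n ≫ f (n + 1) = f n) {n m : ℕ} (h : n ≤ m) : seqTr g h ≫ f m = f n := by
  induction m, h using Nat.le_induction with
  | base => simp
  | succ m h ih => rw [← seqTr_comp g h (Nat.le_succ m), seqTr_succ, Category.assoc, hf, ih]

lemma IsFinitelyAccessible.exists_seqColimit (hB : IsFinitelyAccessible B) {a : ℕ → B}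
    (g : ∀ n, a n ⟶ a (n + 1)) : ∃ (F : B) (i : ∀ n, a n ⟶ F),
      (∀ n, g n ≫ i (n + 1) = i n) ∧
      (∀ {W : B} (f : ∀ n, a n ⟶ W), (∀ n, g n ≫ f (n + 1) = f n) →
        ∃ l : F ⟶ W, ∀ n, i n ≫ l = f n) ∧
      (∀ {W : B} {l l' : F ⟶ W}, (∀ n, i n ≫ l = i n ≫ l') → l = l') ∧
      (∀ {G : B}, IsFinitelyPresentable B G → ∀ x : G ⟶ F, ∃ (n : ℕ) (y : G ⟶ a n),
        y ≫ i n = x) ∧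
      (∀ {G : B}, IsFinitelyPresentable B G → ∀ {n : ℕ} (y y' : G ⟶ a n), y ≫ i n = y' ≫ i n →
        ∃ (m : ℕ) (h : n ≤ m), y ≫ seqTr g h = y' ≫ seqTr g h) := by
  have := hB.hasColimitsOfShape_nat
  let D : ℕ ⥤ B := Functor.ofSequence g
  refine ⟨colimit D, fun n => colimit.ι D n, fun n => ?_, fun {W} f hf => ?_, fun {W l l'} h => ?_,
    fun {G} hG x => ?_, fun {G} hG n y y' h => ?_⟩
  · exact (congrArg (· ≫ colimit.ι D (n + 1)) (seqTr_succ g (Nat.le_succ n)).symm).trans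
      (colimit.w D (homOfLE (Nat.le_succ n)))
  · refine ⟨colimit.desc D ⟨W, { app := f, naturality := fun n m h => ?_ }⟩, fun n => ?_⟩
    · exact (seqTr_comp_of_comp hf (leOfHom h)).trans (Category.comp_id (f n)).symm
    · exact colimit.ι_desc _ n
  · exact colimit.hom_ext h
  · exact hG.exists_lift_nat (colimit.isColimit D) x
  · obtain ⟨k, f, hf⟩ := hG.exists_eq_nat (colimit.isColimit D) y y' h
    exact ⟨k, leOfHom f, hf⟩

lemma IsFinitelyAccessible.exists_split (hB : IsFinitelyAccessible B) {X : B} (e : X ⟶ X)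
    (he : e ≫ e = e) : ∃ (Y : B) (i : Y ⟶ X) (p : X ⟶ Y), i ≫ p = 𝟙 Y ∧ p ≫ i = e := by
  obtain ⟨F, i, w, d, ext, -⟩ := hB.exists_seqColimit (a := fun _ => X) (fun _ => e)
  obtain ⟨l, hl⟩ := d (fun _ => e) (fun _ => he)
  have hall (n : ℕ) : i 0 = i n := by
    induction n with
    | zero => rfl
    | succ n ih => rw [ih, ← w n, ← w (n + 1), ← Category.assoc, he]
  refine ⟨F, l, i 0, ext fun n => ?_, hl 0⟩
  rw [← Category.assoc, hl, Category.comp_id, hall (n + 1), w]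

variable [Preadditive B]

lemma IsFinitelyAccessible.hasCoproducts [HasZeroObject B] [HasBinaryBiproducts B]
    (hB : IsFinitelyAccessible B) : HasCoproducts.{v} B := by
  have := hB.hasFilteredColimits
  have : HasFiniteCoproducts B := hasFiniteCoproducts_of_has_binary_and_initial
  exact hasCoproducts_of_finite_and_filtered

variable [HasZeroObject B] [HasBinaryBiproducts B]

open CoproductsFromFiniteFiltered in
lemma IsFinitelyPresentable.exists_finite_support (hB : IsFinitelyAccessible B) {a : B}
    (ha : IsFinitelyPresentable B a) {I : Type v} {X : I → B} {c : Cofan X} (hc : IsColimit c)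
    (f : a ⟶ c.pt) : ∃ E : Set I, E.Finite ∧ f ≫ cofanProj hc E = f := by
  have := hB.hasFilteredColimits
  have : HasFiniteCoproducts B := hasFiniteCoproducts_of_has_binary_and_initial
  have := hB.hasCoproducts
  let e : ∐ X ≅ c.pt := (colimit.isColimit _).coconePointUniqueUpToIso hc
  obtain ⟨S, y, hy⟩ := ha.exists_lift (isColimitFiniteSubproductsCocone X) (f ≫ e.inv)
  refine ⟨(fun s : Discrete I => s.as) '' (S : Set (Discrete I)), S.finite_toSet.image _, ?_⟩
  have hf : f = y ≫ (finiteSubcoproductsCocone X).ι.app S ≫ e.hom := by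
    have := hy =≫ e.hom
    have h' : (f ≫ e.inv) ≫ e.hom = f := by simp
    exact h'.symm.trans (this.symm.trans (Category.assoc _ _ _))
  suffices H : ((finiteSubcoproductsCocone X).ι.app S ≫ e.hom) ≫ cofanProj hc
      ((fun s : Discrete I => s.as) '' (S : Set (Discrete I))) =
      (finiteSubcoproductsCocone X).ι.app S ≫ e.hom by
    rw [hf, Category.assoc]
    exact congrArg (y ≫ ·) H
  refine Sigma.hom_ext _ _ fun s => ?_
  have he : Sigma.ι X s.1.as ≫ e.hom = c.inj s.1.as :=
    IsColimit.comp_coconePointUniqueUpToIso_hom (colimit.isColimit _) hc (Discrete.mk s.1.as)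
  have h1 : Sigma.ι (fun x : S => (Discrete.functor X).obj x) s ≫
      (finiteSubcoproductsCocone X).ι.app S = Sigma.ι X s.1.as := by
    simp [finiteSubcoproductsCocone]
  have h2 : Sigma.ι (fun x : S => (Discrete.functor X).obj x) s ≫
      (finiteSubcoproductsCocone X).ι.app S ≫ e.hom = c.inj s.1.as :=
    (Category.assoc _ _ _).symm.trans ((congrArg (· ≫ e.hom) h1).trans he)
  have h3 : s.1.as ∈ (fun s : Discrete I => s.as) '' (S : Set (Discrete I)) := ⟨s.1, s.2, rfl⟩
  refine (Category.assoc _ _ _).symm.trans ((congrArg (· ≫ cofanProj hc _) h2).trans ?_)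
  exact (inj_cofanProj_of_mem hc h3).trans h2.symm

end FinitelyAccessible

section Cardinals

open Cardinal

lemma mk_iUnion_le_of_forall_le {ι α : Type v} {κ : Cardinal.{v}} (hκ : ℵ₀ ≤ κ) (E : ι → Set α)
    (hι : #ι ≤ κ) (hE : ∀ i, #(E i) ≤ κ) : #(⋃ i, E i) ≤ κ :=
  mk_iUnion_le_sum_mk.trans <| (sum_le_sum _ _ hE).trans <| by
    rw [sum_const']
    exact (mul_le_mul' hι le_rfl).trans (mul_eq_self hκ).le

lemma exists_type_card_lt_card_nat_arrow (κ₀ : Cardinal.{v}) :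
    ∃ K : Type v, κ₀ ≤ #K ∧ #K < #(ℕ → K) := by
  let f : ℕ → Cardinal.{v} := fun n => Nat.rec κ₀ (fun _ c => Order.succ c) n
  refine ⟨(sum f).out, ?_, ?_⟩
  · rw [mk_out]; exact le_sum f 0
  · have h := sum_lt_prod f (fun _ => sum f) fun n =>
      (Order.lt_succ (f n)).trans_le (le_sum f (n + 1))
    simpa using h

lemma mk_sigma_fin_arrow_le {K : Type v} (hK : ℵ₀ ≤ #K) : #(Σ n : ℕ, Fin n → K) ≤ #K := by
  rw [mk_sigma]
  refine (sum_le_sum _ (fun _ => #K) fun n => ?_).trans ?_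
  · simpa using power_nat_le hK
  · simpa using mul_le_max_of_aleph0_le_right hK |>.trans (by simp [hK])

end Cardinals

section Supports

open Cardinal

variable {B : Type u} [Category.{v} B] [Preadditive B]

lemma supported_iUnion {A I : Type*} {Y : A → B} {X : I → B} {c : Cofan Y} (hc : IsColimit c)
    {d : Cofan X} (hd : IsColimit d) (f : c.pt ⟶ d.pt) (E : A → Set I)
    (hE : ∀ α, (c.inj α ≫ f) ≫ cofanProj hd (E α) = c.inj α ≫ f) :
    f ≫ cofanProj hd (⋃ α, E α) = f := by
  refine cofan_hom_ext hc fun α => ?_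
  rw [← Category.assoc]
  exact supported_mono hd (Set.subset_iUnion E α) (hE α)

variable [HasZeroObject B] [HasBinaryBiproducts B]

lemma IsFinitelyAccessible.exists_support_bound (hB : IsFinitelyAccessible B) (X : B) :
    ∃ κ : Cardinal.{v}, ∀ {I : Type v} {Y : I → B} {c : Cofan Y} (hc : IsColimit c) (f : X ⟶ c.pt),
      ∃ E : Set I, #E ≤ κ ∧ f ≫ cofanProj hc E = f := by
  obtain ⟨ι, G, hG, h⟩ := hB.2
  obtain ⟨p, hp⟩ := h X
  refine ⟨max #p.J ℵ₀, fun {I Y c} hc f => ?_⟩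
  have hf (j : p.J) : IsFinitelyPresentable B (p.D.obj j) := by
    obtain ⟨i, hi⟩ := hp j
    exact hi ▸ hG i
  choose E hE hE' using fun j => (hf j).exists_finite_support hB hc (p.c.ι.app j ≫ p.iso.hom ≫ f)
  refine ⟨⋃ j, E j, mk_iUnion_le_of_forall_le (le_max_right _ _) _ (le_max_left _ _)
    fun j => (hE j).lt_aleph0.le.trans (le_max_right _ _), ?_⟩
  rw [← cancel_epi p.iso.hom, ← Category.assoc]
  refine p.hc.hom_ext fun j => ?_
  rw [← Category.assoc]
  exact supported_mono hc (Set.subset_iUnion E j) (hE' j)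

lemma IsFinitelyAccessible.exists_cofan (hB : IsFinitelyAccessible B) {I : Type v} (X : I → B) :
    ∃ c : Cofan X, Nonempty (IsColimit c) := by
  have := hB.hasCoproducts
  exact ⟨_, ⟨coproductIsCoproduct X⟩⟩

end Supports

section DescendingChain

variable {B : Type u} [Category.{v} B] [Preadditive B]

/-- The restriction of an infinite sequence, as a vertex of the tree of finite sequences. -/
def treeNode {K : Type v} (β : ℕ → K) (n : ℕ) : Σ n : ℕ, Fin n → K := ⟨n, fun i => β i⟩

lemma eventually_treeNode_ne {K : Type v} (β : ℕ → K) (s : Σ n : ℕ, Fin n → K) :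
    ∀ᶠ m in Filter.atTop, treeNode β m ≠ s := by
  filter_upwards [Filter.eventually_gt_atTop s.1] with m hm h
  exact hm.ne (congrArg Sigma.fst h).symm

lemma eventually_treeNode_ne_treeNode {K : Type v} {β β' : ℕ → K} (h : β' ≠ β) :
    ∀ᶠ m in Filter.atTop, treeNode β' m ≠ treeNode β m := by
  obtain ⟨n, hn⟩ := Function.ne_iff.1 h
  filter_upwards [Filter.eventually_gt_atTop n] with m hm h
  simp only [treeNode, Sigma.mk.injEq, heq_eq_eq, true_and] at h
  exact hn (congrFun h ⟨n, hm⟩)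

variable [HasBinaryBiproducts B]

/-- The colimit of a sequence of objects `P ⊞ ∐ a n`, with twisted transition morphisms. -/
lemma IsFinitelyAccessible.exists_twistedColimit (hB : IsFinitelyAccessible B) {a : ℕ → B}
    (g : ∀ n, a n ⟶ a (n + 1)) {I : Type v} {P : B} (ν : ∀ n, I → (a n ⟶ P))
    (d : ∀ n, Cofan fun _ : I => a n) (hd : ∀ n, IsColimit (d n)) :
    ∃ (M : B) (j : P ⟶ M) (x : ∀ n, (d n).pt ⟶ M),
      (∀ n β, (d n).inj β ≫ x n =
        g n ≫ (d (n + 1)).inj β ≫ x (n + 1) + ν n β ≫ j) ∧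
      (∀ {W : B} (p : P ⟶ W) (y : ∀ n, I → (a n ⟶ W)),
        (∀ n β, y n β = g n ≫ y (n + 1) β + ν n β ≫ p) →
        ∃ l : M ⟶ W, j ≫ l = p ∧ ∀ n β, (d n).inj β ≫ x n ≫ l = y n β) ∧
      (∀ {W : B} {l l' : M ⟶ W}, j ≫ l = j ≫ l' →
        (∀ n β, (d n).inj β ≫ x n ≫ l = (d n).inj β ≫ x n ≫ l') → l = l') ∧
      (∀ {G : B}, IsFinitelyPresentable B G → ∀ z : G ⟶ M, ∃ (n : ℕ) (u : G ⟶ P)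
        (v : G ⟶ (d n).pt), z = u ≫ j + v ≫ x n) := by
  let t (n : ℕ) : P ⊞ (d n).pt ⟶ P ⊞ (d (n + 1)).pt :=
    biprod.desc biprod.inl (cofanDesc (hd n) fun β =>
      g n ≫ (d (n + 1)).inj β ≫ biprod.inr + ν n β ≫ biprod.inl)
  obtain ⟨M, i, w, desc, ext, lift, -⟩ := hB.exists_seqColimit t
  have hj (n : ℕ) : biprod.inl ≫ i n = (biprod.inl : P ⟶ _) ≫ i 0 := by
    induction n with
    | zero => rfl
    | succ n ih => rw [← ih, ← w n]; simp [t]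
  have hx (n : ℕ) (β : I) : (d n).inj β ≫ biprod.inr ≫ i n =
      g n ≫ (d (n + 1)).inj β ≫ biprod.inr ≫ i (n + 1) +
        ν n β ≫ biprod.inl ≫ i 0 := by
    rw [← w n, ← hj (n + 1)]
    simp [t]
  refine ⟨M, biprod.inl ≫ i 0, fun n => biprod.inr ≫ i n, hx, fun {W} p y h => ?_,
    fun {W l l'} h h' => ?_, fun {G} hG z => ?_⟩
  · obtain ⟨l, hl⟩ := desc (fun n => biprod.desc p (cofanDesc (hd n) (y n))) fun n => by
      refine biprod.hom_ext' _ _ ?_ ?_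
      · simp [t]
      · refine cofan_hom_ext (hd n) fun β => ?_
        simp [t, ← h]
    exact ⟨l, by simp [hl], fun n β => by simp [hl]⟩
  · refine ext fun n => biprod.hom_ext' _ _ ?_ ?_
    · simpa [reassoc_of% hj n] using h
    · exact cofan_hom_ext (hd n) fun β => by simpa using h' n β
  · obtain ⟨n, y, rfl⟩ := lift hG z
    refine ⟨n, y ≫ biprod.fst, y ≫ biprod.snd, ?_⟩
    rw [← hj n]
    have h := congrArg (fun e => y ≫ e ≫ i n) (biprod.total (X := P) (Y := (d n).pt))
    simpa only [Preadditive.add_comp, Preadditive.comp_add, Category.assoc, Category.id_comp]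
      using h.symm

variable [HasZeroObject B]

open Cardinal in
/-- In a pure semisimple finitely accessible category, sequences of finitely presentable objects
satisfy a Mittag-Leffler type condition. -/
lemma IsPureSemisimple.exists_seqTr_factors (hB : IsFinitelyAccessible B)
    (hS : IsPureSemisimple.{v} B) {a : ℕ → B} (ha : ∀ n, IsFinitelyPresentable B (a n))
    (g : ∀ n, a n ⟶ a (n + 1)) :
    ∃ m, ∀ k, ∃ h : a k ⟶ a m, seqTr g k.zero_le ≫ h = seqTr g m.zero_le := by
  obtain ⟨X, hX⟩ := hS
  obtain ⟨κ, hκ⟩ := hB.exists_support_bound X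
  obtain ⟨K, hK, hK'⟩ := exists_type_card_lt_card_nat_arrow (max κ ℵ₀)
  have hKinf : ℵ₀ ≤ #K := (le_max_right _ _).trans hK
  obtain ⟨F, i, wF, descF, extF, -, eqF⟩ := hB.exists_seqColimit g
  obtain ⟨cP, ⟨hP⟩⟩ := hB.exists_cofan fun s : Σ n : ℕ, Fin n → K => a s.1
  choose d hd using fun n => hB.exists_cofan fun _ : ℕ → K => a n
  replace hd := fun n => (hd n).some
  obtain ⟨cF, ⟨hF⟩⟩ := hB.exists_cofan fun _ : ℕ → K => F
  let ν (n : ℕ) (β : ℕ → K) : a n ⟶ cP.pt := cP.inj (treeNode β n)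
  obtain ⟨M, j, x, hx, descM, extM, liftM⟩ := hB.exists_twistedColimit g ν d hd
  obtain ⟨I, cI, hI, s, r, hsr⟩ := hX M
  -- the object `cP.pt` is supported on few copies of `X`
  have hfin (t : Σ n : ℕ, Fin n → K) : ∃ E : Set I, E.Finite ∧
      (cP.inj t ≫ j ≫ s) ≫ cofanProj hI E = cP.inj t ≫ j ≫ s :=
    (ha t.1).exists_finite_support hB hI _
  choose E hE hE' using hfin
  have hEcard : #(⋃ t, E t : Set I) ≤ #K := mk_iUnion_le_of_forall_le hKinf _
    (mk_sigma_fin_arrow_le hKinf) fun t => (hE t).lt_aleph0.le.trans hKinf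
  have hjs := supported_iUnion hP hI (j ≫ s) E hE'
  set U : Set I := ⋃ t, E t
  let θ : M ⟶ M := s ≫ cofanProj hI U ≫ r
  have hjθ : j ≫ θ = j := by
    rw [← Category.assoc, ← Category.assoc, hjs, Category.assoc, hsr, Category.comp_id]
  obtain ⟨q, hjq, hxq⟩ := descM (0 : cP.pt ⟶ cF.pt) (fun n β => i n ≫ cF.inj β) fun n β => by
    simp [reassoc_of% wF n]
  -- a branch which is missed by `θ`
  obtain ⟨V, hV, hV'⟩ : ∃ V : Set (ℕ → K), #V ≤ #K ∧ (θ ≫ q) ≫ cofanProj hF V = θ ≫ q := by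
    choose E' hE' hE'' using fun k : I => hκ hF (cI.inj k ≫ r ≫ q)
    refine ⟨⋃ k : U, E' k, mk_iUnion_le_of_forall_le hKinf _ hEcard fun k =>
      (hE' k).trans ((le_max_left _ _).trans hK), ?_⟩
    have : (cofanProj hI U ≫ r ≫ q) ≫ cofanProj hF (⋃ k : U, E' k) =
        cofanProj hI U ≫ r ≫ q := by
      refine cofan_hom_ext hI fun k => ?_
      by_cases hk : k ∈ U
      · have := supported_mono hF (Set.subset_iUnion (fun k : U => E' k) ⟨k, hk⟩) (hE'' k)
        simpa [inj_cofanProj_of_mem_assoc hI hk] using this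
      · simp [inj_cofanProj_of_notMem_assoc hI hk]
    simp only [θ, Category.assoc] at this ⊢
    rw [this]
  obtain ⟨β, hβ⟩ : ∃ β, β ∉ V := by
    by_contra! h
    rw [Set.eq_univ_of_forall h, mk_univ] at hV
    exact hV.not_gt hK'
  have hθβ : θ ≫ q ≫ cofanPi hF β = 0 := by
    rw [← Category.assoc, ← hV', Category.assoc, cofanProj_comp_cofanPi_of_notMem hF hβ, comp_zero]
  obtain ⟨σ, hσ⟩ := descF (fun n => (d n).inj β ≫ x n ≫ (𝟙 M - θ)) fun n => by
    have h0 : j ≫ (𝟙 M - θ) = 0 := by simp [hjθ]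
    have := hx n β =≫ (𝟙 M - θ)
    simp only [Preadditive.add_comp, Category.assoc, h0, comp_zero, add_zero] at this
    exact this.symm
  have hσq (n : ℕ) : i n ≫ σ ≫ q ≫ cofanPi hF β = i n := by
    rw [← Category.assoc, hσ]
    have h1 : (d n).inj β ≫ x n ≫ q ≫ cofanPi hF β = i n := by
      rw [reassoc_of% hxq n β, inj_cofanPi, Category.comp_id]
    simp [Preadditive.sub_comp, hθβ, h1]
  -- the composition `i 0 ≫ σ` has finite support
  obtain ⟨N, u, v, huv⟩ := liftM (ha 0) (i 0 ≫ σ)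
  obtain ⟨Eu, hEu, hu⟩ := (ha 0).exists_finite_support hB hP u
  obtain ⟨Ev, hEv, hv⟩ := (ha 0).exists_finite_support hB (hd N) v
  have hxqβ : x N ≫ q ≫ cofanPi hF β = cofanPi (hd N) β ≫ i N := by
    refine cofan_hom_ext (hd N) fun β' => ?_
    rw [reassoc_of% hxq N β']
    by_cases h : β' = β
    · subst h
      rw [inj_cofanPi, Category.comp_id, inj_cofanPi_assoc]
    · rw [inj_cofanPi_of_ne _ h, comp_zero, inj_cofanPi_of_ne_assoc _ h]
  obtain ⟨m₀, hm₀, hm₀'⟩ : ∃ (m : ℕ) (h : N ≤ m), (v ≫ cofanPi (hd N) β) ≫ seqTr g h =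
      seqTr g N.zero_le ≫ seqTr g h := by
    refine eqF (ha 0) _ _ ?_
    rw [seqTr_comp_of_comp wF, ← hσq 0, ← Category.assoc, huv]
    simp [reassoc_of% hjq, hxqβ]
  obtain ⟨m, hm, hm₁, hm₂⟩ : ∃ m, m₀ ≤ m ∧ (∀ s ∈ Eu, treeNode β m ≠ s) ∧
      ∀ β' ∈ Ev, β' ≠ β → treeNode β' m ≠ treeNode β m := by
    refine ((Filter.eventually_ge_atTop m₀).and
      (((Filter.eventually_all_finite hEu).2 fun s _ => eventually_treeNode_ne β s).and
      ((Filter.eventually_all_finite hEv).2 fun β' _ => ?_))).exists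
    by_cases h : β' = β
    · simp [h]
    · filter_upwards [eventually_treeNode_ne_treeNode h] with m hm _ using hm
  have hNm := hm₀.trans hm
  classical
  obtain ⟨π, hπ₁, hπ₂, hπ₃⟩ : ∃ π : cP.pt ⟶ a m,
      (∀ β', treeNode β' m = treeNode β m → ν m β' ≫ π = 𝟙 (a m)) ∧
      (∀ n β', treeNode β' n ≠ treeNode β m → ν n β' ≫ π = 0) ∧
      ∀ U, treeNode β m ∉ U → cofanProj hP U ≫ π = 0 := by
    refine ⟨cofanPi hP (treeNode β m), fun β' h => ?_, fun n β' h => inj_cofanPi_of_ne hP h,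
      fun U hU => cofanProj_comp_cofanPi_of_notMem hP hU⟩
    simp only [treeNode, Sigma.mk.injEq, heq_eq_eq, true_and] at h
    change cP.inj ⟨m, fun i => β' i⟩ ≫ _ = _
    rw [h]
    exact inj_cofanPi hP (treeNode β m)
  obtain ⟨ρ, hjρ, hxρ⟩ := descM π (fun n β' =>
      if h : n ≤ m ∧ treeNode β' m = treeNode β m then seqTr g h.1 else 0) fun n β' => by
    by_cases hnode : treeNode β' n = treeNode β m
    · obtain rfl : n = m := congrArg Sigma.fst hnode
      rw [dif_pos ⟨le_rfl, hnode⟩, dif_neg fun h => by lia, hπ₁ _ hnode, comp_zero, zero_add,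
        seqTr_refl]
    · rw [hπ₂ _ _ hnode, add_zero]
      by_cases hn : n + 1 ≤ m
      · by_cases h : treeNode β' m = treeNode β m
        · rw [dif_pos ⟨by lia, h⟩, dif_pos ⟨hn, h⟩, ← seqTr_succ g (Nat.le_succ n), seqTr_comp]
        · simp [h]
      · have : ¬ (n ≤ m ∧ treeNode β' m = treeNode β m) := by
          rintro ⟨h1, h2⟩
          obtain rfl : n = m := by lia
          exact hnode h2
        simp [hn, this]
  have key : i 0 ≫ σ ≫ ρ = seqTr g m.zero_le := by
    have hu0 : u ≫ π = 0 := by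
      rw [← hu, Category.assoc, hπ₃ Eu fun h => hm₁ _ h rfl, comp_zero]
    have hv0 : cofanProj (hd N) Ev ≫ x N ≫ ρ =
        cofanProj (hd N) Ev ≫ cofanPi (hd N) β ≫ seqTr g hNm := by
      refine cofan_hom_ext (hd N) fun β' => ?_
      by_cases h : β' ∈ Ev
      · rw [inj_cofanProj_of_mem_assoc (hd N) h, inj_cofanProj_of_mem_assoc (hd N) h, hxρ]
        by_cases hβ' : β' = β
        · subst hβ'
          rw [dif_pos ⟨hNm, rfl⟩, inj_cofanPi_assoc]
        · rw [dif_neg fun h' => hm₂ β' h hβ' h'.2, inj_cofanPi_of_ne_assoc _ hβ']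
      · rw [inj_cofanProj_of_notMem_assoc (hd N) h, inj_cofanProj_of_notMem_assoc (hd N) h]
    have hv1 : v ≫ x N ≫ ρ = seqTr g m.zero_le := by
      rw [← hv, Category.assoc, hv0, reassoc_of% hv, ← seqTr_comp g hm₀ hm, ← Category.assoc,
        ← Category.assoc, hm₀', seqTr_comp, seqTr_comp]
    rw [← Category.assoc, huv, Preadditive.add_comp, Category.assoc, Category.assoc, hjρ, hu0, hv1,
      zero_add]
  exact ⟨m, fun k => ⟨i k ≫ σ ≫ ρ, by rw [← Category.assoc, seqTr_comp_of_comp wF, key]⟩⟩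

end DescendingChain

section FpSet

variable {B : Type u} [Category.{v} B]

lemma IsFinitelyAccessible.exists_fpSet (hB : IsFinitelyAccessible B) :
    ∃ (ι : Type v) (G : ι → B), (∀ i, IsFinitelyPresentable B (G i)) ∧
      ∀ a, IsFinitelyPresentable B a → ∃ i, Nonempty (a ≅ G i) := by
  obtain ⟨ι, G, hG, h⟩ := hB.2
  choose Y s r hsr hrs using fun e : Σ i, {e : G i ⟶ G i // e ≫ e = e} =>
    hB.exists_split e.2.1 e.2.2
  refine ⟨_, Y, fun e => (hG e.1).of_retract _ _ (hsr e), fun a ha => ?_⟩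
  obtain ⟨p, hp⟩ := h a
  obtain ⟨j, y, hy⟩ := ha.exists_lift p.hc p.iso.inv
  obtain ⟨i, hi⟩ := hp j
  obtain ⟨y, z, hyz⟩ : ∃ (y : a ⟶ G i) (z : G i ⟶ a), y ≫ z = 𝟙 a := by
    rw [hi]
    exact ⟨y, p.c.ι.app j ≫ p.iso.hom, by rw [← Category.assoc, hy, p.iso.inv_hom_id]⟩
  let e : Σ i, {e : G i ⟶ G i // e ≫ e = e} := ⟨i, z ≫ y, by simp [reassoc_of% hyz]⟩
  refine ⟨e, ⟨⟨y ≫ r e, s e ≫ z, ?_, ?_⟩⟩⟩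
  · have := y ≫= hrs e =≫ z
    simpa [e, hyz] using this
  · have := s e ≫= hrs e =≫ r e
    simpa [hsr, e] using this.symm

end FpSet

section Ring

/-- In a ring with descending chain condition on principal left ideals, an element such that the
left ideal it generates contains no nonzero idempotents is nilpotent. -/
lemma isNilpotent_of_forall_isIdempotentElem {R : Type*} [Ring R]
    (hR : WellFounded fun y' y : R => (∃ r, r * y = y') ∧ ¬ ∃ h, h * y' = y) (z : R)
    (hz : ∀ r : R, IsIdempotentElem (r * z) → r * z = 0) : IsNilpotent z := by
  by_contra hn
  obtain ⟨y, ⟨⟨r, rfl⟩, hy⟩, hmin⟩ := hR.has_min {y | (∃ r, r * z = y) ∧ ¬ IsNilpotent y}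
    ⟨z, ⟨1, one_mul z⟩, hn⟩
  have hmin' (t : R) (ht : ¬ IsNilpotent (t * (r * z))) : ∃ h, h * (t * (r * z)) = r * z := by
    by_contra h
    exact hmin (t * (r * z)) ⟨⟨t * r, mul_assoc _ _ _⟩, ht⟩ ⟨⟨t, rfl⟩, h⟩
  have hr (t : R) : t * (r * z) = (t * r) * z := (mul_assoc _ _ _).symm
  generalize hw : r * z = y at *
  obtain ⟨h, hh⟩ := hmin' y fun h => hy (by
    obtain ⟨n, hn⟩ := h
    exact ⟨2 * n, by rw [pow_mul, pow_two, hn]⟩)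
  set p := h * y with hp
  have hpy : p * y = y := by rw [hp, mul_assoc, hh]
  have hq : IsNilpotent (p - p ^ 2) := by
    by_contra hq
    have hq' : p - p ^ 2 = (h - h * y * h) * y := by
      rw [hp]; noncomm_ring
    rw [hq'] at hq
    obtain ⟨s, hs⟩ := hmin' _ hq
    rw [← hq'] at hs
    refine hy ⟨2, ?_⟩
    rw [pow_two]
    nth_rw 1 [← hs]
    rw [mul_assoc, sub_mul, pow_two, mul_assoc p p y, hpy, hpy, sub_self, mul_zero]
  obtain ⟨n, hn⟩ := hq
  have he := isIdempotentElem_one_sub_one_sub_pow_pow p (n + 1) (by rw [pow_succ, hn, zero_mul])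
  obtain ⟨t, ht⟩ : ∃ t, t * z = 1 - (1 - p ^ (n + 1)) ^ (n + 1) := by
    have hcomm : Commute (1 : R) (1 - p ^ (n + 1)) := Commute.one_left _
    have h2 := (hcomm.mul_geom_sum₂ (n + 1))
    have h3 : ∃ t, t * p ^ (n + 1) = 1 - (1 - p ^ (n + 1)) ^ (n + 1) := by
      have h4 := hcomm.geom_sum₂_mul (n + 1)
      rw [one_pow, sub_sub_cancel] at h4
      exact ⟨_, h4⟩
    obtain ⟨t, ht⟩ := h3
    refine ⟨t * p ^ n * h * r, ?_⟩
    rw [← ht, pow_succ, hp, mul_assoc, hw]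
    simp only [mul_assoc]
  have h0 := hz t (ht ▸ he)
  rw [ht, sub_eq_zero] at h0
  have h1 : (1 - p ^ (n + 1)) * y = 0 := by
    have : ∀ k, p ^ k * y = y := fun k => by
      induction k with
      | zero => simp
      | succ k ih => rw [pow_succ, mul_assoc, hpy, ih]
    rw [sub_mul, this, one_mul, sub_self]
  refine hy ?_
  rw [← one_mul y, h0, pow_succ, mul_assoc, h1, mul_zero]
  exact IsNilpotent.zero

end Ring

section WellFounded

variable {B : Type u} [Category.{v} B] [Preadditive B] [HasZeroObject B] [HasBinaryBiproducts B]

/-- The finitely presentable objects under a given object. -/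
structure FpUnder (a₀ : B) where
  /-- the object -/
  obj : B
  /-- the structure morphism -/
  hom : a₀ ⟶ obj
  fp : IsFinitelyPresentable B obj

/-- One object under `a₀` is strictly smaller than another one if it admits a morphism from it,
but no morphism to it. -/
def FpUnder.Lt {a₀ : B} (c a : FpUnder a₀) : Prop :=
  (∃ α : a.obj ⟶ c.obj, a.hom ≫ α = c.hom) ∧ ¬ ∃ h : c.obj ⟶ a.obj, c.hom ≫ h = a.hom

lemma IsPureSemisimple.wellFounded_fpUnder_lt (hB : IsFinitelyAccessible B)
    (hS : IsPureSemisimple.{v} B) (a₀ : B) : WellFounded (FpUnder.Lt (a₀ := a₀)) := by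
  rw [wellFounded_iff_isEmpty_descending_chain]
  refine ⟨fun ⟨f, hf⟩ => ?_⟩
  choose α hα using fun n => (hf n).1
  have hn := fun n => (hf n).2
  obtain ⟨m, hm⟩ := hS.exists_seqTr_factors hB (fun n => (f n).fp) α
  have key (n : ℕ) : (f 0).hom ≫ seqTr (a := fun n => (f n).obj) α n.zero_le = (f n).hom := by
    induction n with
    | zero => simp
    | succ n ih => rw [← hα, ← ih, Category.assoc, ← seqTr_succ α n.le_succ, seqTr_comp]
  obtain ⟨h, hh⟩ := hm (m + 1)
  have h' := (f 0).hom ≫= hh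
  rw [← Category.assoc, key (m + 1), key m] at h'
  exact hn m ⟨h, h'⟩

lemma IsPureSemisimple.wellFounded_end (hB : IsFinitelyAccessible B) (hS : IsPureSemisimple.{v} B)
    {a : B} (ha : IsFinitelyPresentable B a) :
    WellFounded fun y' y : End a => (∃ r, r * y = y') ∧ ¬ ∃ h, h * y' = y :=
  InvImage.wf (fun e : End a => (⟨a, e, ha⟩ : FpUnder a)) (hS.wellFounded_fpUnder_lt hB a)

end WellFounded

section Subcoproducts

variable {C : Type*} [Category* C] [Preadditive C] {I : Type*} {X : I → C} {c : Cofan X}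

/-- The inclusion of a subcoproduct. -/
def subcofanIncl (c : Cofan X) {U : Set I} {c' : Cofan fun i : U => X i} (hc' : IsColimit c') :
    c'.pt ⟶ c.pt :=
  cofanDesc hc' fun i => c.inj i

variable (hc : IsColimit c) {U : Set I} {c' : Cofan fun i : U => X i} (hc' : IsColimit c')

open Classical in
/-- The projection onto a subcoproduct. -/
noncomputable def subcofanProj (U : Set I) (c' : Cofan fun i : U => X i) : c.pt ⟶ c'.pt :=
  cofanDesc hc fun i => if h : i ∈ U then c'.inj ⟨i, h⟩ else 0

omit [Preadditive C] in
lemma inj_subcofanIncl (i : U) : c'.inj i ≫ subcofanIncl c hc' = c.inj i.1 := by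
  simp [subcofanIncl]

lemma inj_subcofanProj_of_mem {i : I} (h : i ∈ U) :
    c.inj i ≫ subcofanProj hc U c' = c'.inj ⟨i, h⟩ := by
  simp [subcofanProj, h]

lemma inj_subcofanProj_of_notMem {i : I} (h : i ∉ U) : c.inj i ≫ subcofanProj hc U c' = 0 := by
  simp [subcofanProj, h]

@[simp]
lemma subcofanIncl_comp_subcofanProj :
    subcofanIncl c hc' ≫ subcofanProj hc U c' = 𝟙 _ := by
  refine cofan_hom_ext hc' fun i => ?_
  rw [← Category.assoc, inj_subcofanIncl, inj_subcofanProj_of_mem hc i.2, Category.comp_id]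

@[simp]
lemma subcofanProj_comp_subcofanIncl :
    subcofanProj hc U c' ≫ subcofanIncl c hc' = cofanProj hc U := by
  refine cofan_hom_ext hc fun i => ?_
  rw [← Category.assoc]
  by_cases h : i ∈ U
  · rw [inj_subcofanProj_of_mem hc h, inj_subcofanIncl, inj_cofanProj_of_mem hc h]
  · rw [inj_subcofanProj_of_notMem hc h, inj_cofanProj_of_notMem hc h, zero_comp]

@[simp]
lemma subcofanIncl_comp_cofanProj :
    subcofanIncl c hc' ≫ cofanProj hc U = subcofanIncl c hc' := by
  rw [← subcofanProj_comp_subcofanIncl hc hc', ← Category.assoc, subcofanIncl_comp_subcofanProj,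
    Category.id_comp]

end Subcoproducts

section Structure

variable {B : Type u} [Category.{v} B] [Preadditive B] [HasZeroObject B] [HasBinaryBiproducts B]

/-- A family of representatives of the isomorphism classes of finitely presentable objects. -/
structure IsFpFamily {ι : Type v} (G : ι → B) : Prop where
  fp : ∀ i, IsFinitelyPresentable B (G i)
  exists_iso : ∀ a, IsFinitelyPresentable B a → ∃ i, Nonempty (a ≅ G i)

lemma IsPureSemisimple.exists_stable_summand (hB : IsFinitelyAccessible B)
    (hS : IsPureSemisimple.{v} B) {ι : Type v} {G : ι → B} (hG : IsFpFamily G)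
    {Y Y' : B} (d : Y ⟶ Y') (N : ∀ a, AddSubgroup (a ⟶ Y))
    (hN : ∀ {a b : B} (f : a ⟶ b) {x : b ⟶ Y}, x ∈ N b → f ≫ x ∈ N a)
    {a₀ : B} (ha₀ : IsFinitelyPresentable B a₀) (x₀ : a₀ ⟶ Y) (hx₀ : x₀ ≫ d = 0) :
    ∃ (i : ι) (x : G i ⟶ Y) (u : a₀ ⟶ G i), x ≫ d = 0 ∧ x₀ - u ≫ x ∈ N a₀ ∧
      ∀ {c : B} (_ : IsFinitelyPresentable B c) (α : G i ⟶ c) (w : c ⟶ Y), w ≫ d = 0 →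
        x - α ≫ w ∈ N (G i) → ∃ l : c ⟶ G i, α ≫ l = 𝟙 _ := by
  obtain ⟨⟨a, u, ha⟩, ⟨x, hx, hux⟩, hmin⟩ := (hS.wellFounded_fpUnder_lt hB a₀).has_min
    {a | ∃ x : a.obj ⟶ Y, x ≫ d = 0 ∧ x₀ - a.hom ≫ x ∈ N a₀}
    ⟨⟨a₀, 𝟙 _, ha₀⟩, x₀, hx₀, by simp⟩
  dsimp only at x hx hux
  have hmin' {c : B} (hc : IsFinitelyPresentable B c) (α : a ⟶ c) (w : c ⟶ Y) (hw : w ≫ d = 0)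
      (hα : x - α ≫ w ∈ N a) : ∃ h : c ⟶ a, u ≫ α ≫ h = u := by
    by_contra! hh
    refine hmin ⟨c, u ≫ α, hc⟩ ⟨w, hw, ?_⟩ ⟨⟨α, rfl⟩, ?_⟩
    · have := add_mem hux (hN u hα)
      simpa using this
    · rintro ⟨h, hh'⟩
      exact hh h (by simpa using hh')
  obtain ⟨e, ⟨hee, hue⟩, hemin⟩ := (InvImage.wf (fun e : a ⟶ a => (⟨a, e, ha⟩ : FpUnder a))
    (hS.wellFounded_fpUnder_lt hB a)).has_min {e | e ≫ e = e ∧ u ≫ e = u} ⟨𝟙 _, by simp, by simp⟩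
  obtain ⟨E, s, π, hsπ, hπs⟩ := hB.exists_split e hee
  obtain ⟨i, ⟨iso⟩⟩ := hG.exists_iso E (ha.of_retract _ _ hsπ)
  obtain ⟨s, π, hsπ, hπs⟩ : ∃ (s : G i ⟶ a) (π : a ⟶ G i), s ≫ π = 𝟙 _ ∧ π ≫ s = e :=
    ⟨iso.inv ≫ s, π ≫ iso.hom, by simp [reassoc_of% hsπ], by simpa using hπs⟩
  have hidem (t : G i ⟶ G i) (ht : t ≫ t = t) (hut : u ≫ π ≫ t = u ≫ π) : t = 𝟙 _ := by
    by_contra hne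
    have hs : s ≫ e = s := by rw [← hπs, reassoc_of% hsπ]
    have hπ : e ≫ π = π := by rw [← hπs, Category.assoc, hsπ, Category.comp_id]
    refine hemin (π ≫ t ≫ s) ⟨?_, ?_⟩ ⟨⟨π ≫ t ≫ s, ?_⟩, ?_⟩
    · simp [reassoc_of% hsπ, reassoc_of% ht]
    · simp [reassoc_of% hut, hπs, hue]
    · simp [reassoc_of% hπ]
    · rintro ⟨h, hh⟩
      dsimp only at h hh
      refine hne ?_
      have h1 : (π ≫ t ≫ s) ≫ (π ≫ t ≫ s) = π ≫ t ≫ s := by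
        simp [reassoc_of% hsπ, reassoc_of% ht]
      have h2 : (π ≫ t ≫ s) ≫ e = e := by rw [← hh, ← Category.assoc, h1]
      have h3 : π ≫ t ≫ s = e := by
        rw [← h2]; simp [hs]
      have h4 := s ≫= h3 =≫ π
      simpa [reassoc_of% hsπ, hsπ, ← hπs] using h4
  have hunit (t : G i ⟶ G i) (hut : u ≫ π ≫ t = u ≫ π) : IsIso t := by
    let t' : End (G i) := t
    have hnil := isNilpotent_of_forall_isIdempotentElem (hS.wellFounded_end hB (hG.fp i))
      (1 - t') fun r hr => by
        have h0 : u ≫ π ≫ ((𝟙 _ - t) ≫ r) = 0 := by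
          rw [← Category.assoc π, ← Category.assoc u, Preadditive.comp_sub, Preadditive.comp_sub,
            hut]
          simp
        have h1 : 1 - r * (1 - t') = 1 := by
          refine hidem _ hr.one_sub ?_
          change u ≫ π ≫ (𝟙 _ - (𝟙 _ - t) ≫ r) = _
          rw [Preadditive.comp_sub, Preadditive.comp_sub, h0]
          simp
        simpa using h1
    have : IsUnit t' := by
      have := hnil.isUnit_one_sub
      rwa [sub_sub_cancel] at this
    exact (isUnit_iff_isIso _).1 this
  refine ⟨i, s ≫ x, u ≫ π, by rw [Category.assoc, hx, comp_zero], ?_, fun {c} hc α w hw hα => ?_⟩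
  · rwa [Category.assoc, reassoc_of% hπs, reassoc_of% hue]
  · obtain ⟨h, hh⟩ := hmin' (hc.biprod ha) (biprod.lift (π ≫ α) (𝟙 _ - e)) (biprod.desc w x)
      (by refine biprod.hom_ext' _ _ ?_ ?_ <;> simp [hw, hx]) (by
        have := hN π hα
        rw [Preadditive.comp_sub, reassoc_of% hπs] at this
        convert this using 1
        simp only [biprod.lift_desc, Category.assoc, Preadditive.sub_comp, Category.id_comp]
        abel)
    have hh' : u ≫ π ≫ α ≫ biprod.inl ≫ h = u := by
      have h1 : biprod.lift (π ≫ α) (𝟙 _ - e) ≫ h =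
          π ≫ α ≫ biprod.inl ≫ h + (𝟙 _ - e) ≫ biprod.inr ≫ h := by
        rw [biprod.lift_eq]; simp
      rw [h1, Preadditive.comp_add, ← Category.assoc u (𝟙 _ - e), Preadditive.comp_sub, hue] at hh
      simpa using hh
    have := hunit (α ≫ biprod.inl ≫ h ≫ π) (by rw [reassoc_of% hh'])
    exact ⟨(biprod.inl ≫ h ≫ π) ≫ inv (α ≫ biprod.inl ≫ h ≫ π), by
      rw [← Category.assoc]; exact IsIso.hom_inv_id _⟩

open ZeroObject in
/-- The structure theorem for "kernels" of morphisms satisfying a flatness condition. -/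
lemma IsPureSemisimple.exists_fp_cover (hB : IsFinitelyAccessible B)
    (hS : IsPureSemisimple.{v} B) {ι : Type v} {G : ι → B} (hG : IsFpFamily G)
    {Y Y' : B} (d : Y ⟶ Y')
    (hd : ∀ {a b : B} (_ : IsFinitelyPresentable B a) (_ : IsFinitelyPresentable B b) (f : a ⟶ b)
      (x : b ⟶ Y), x ≫ d = 0 → f ≫ x = 0 → ∃ (c : B) (_ : IsFinitelyPresentable B c) (α : b ⟶ c)
        (w : c ⟶ Y), w ≫ d = 0 ∧ x = α ≫ w ∧ f ≫ α = 0) :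
    ∃ (I : Type v) (a : I → ι) (c : Cofan fun i => G (a i)) (_ : IsColimit c) (φ : c.pt ⟶ Y),
      φ ≫ d = 0 ∧ (∀ {b : B} (_ : IsFinitelyPresentable B b) (x : b ⟶ Y), x ≫ d = 0 →
        ∃ u : b ⟶ c.pt, u ≫ φ = x) ∧
      ∀ {b : B} (_ : IsFinitelyPresentable B b) (u : b ⟶ c.pt), u ≫ φ = 0 → u = 0 := by
  let Idx : Type v := Σ i : ι, {x : G i ⟶ Y // x ≫ d = 0}
  obtain ⟨c, ⟨hc⟩⟩ := hB.exists_cofan fun i : Idx => G i.1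
  let Φ : c.pt ⟶ Y := cofanDesc hc fun i => i.2.1
  have hΦ : Φ ≫ d = 0 := cofan_hom_ext hc fun i => by simp [Φ, i.2.2]
  let pure : Set (Set Idx) := {U | ∀ {a b : B} (_ : IsFinitelyPresentable B a)
    (_ : IsFinitelyPresentable B b) (f : a ⟶ b) (u : a ⟶ c.pt) (y : b ⟶ Y),
    u ≫ cofanProj hc U = u → y ≫ d = 0 → u ≫ Φ = f ≫ y →
      ∃ z : b ⟶ c.pt, z ≫ cofanProj hc U = z ∧ f ≫ z = u}
  obtain ⟨U, hU⟩ : ∃ U, Maximal (· ∈ pure) U := by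
    refine zorn_subset pure fun C hC hchain => ?_
    rcases C.eq_empty_or_nonempty with rfl | hne
    · refine ⟨∅, fun {a b} _ _ f u y hu _ _ => ⟨0, by simp, ?_⟩, by simp⟩
      rw [cofanProj_empty, comp_zero] at hu
      simp [← hu]
    · refine ⟨⋃₀ C, fun {a b} ha hb f u y hu hy huy => ?_, fun s hs => Set.subset_sUnion_of_mem hs⟩
      obtain ⟨E, hE, huE⟩ := ha.exists_finite_support hB hc u
      obtain ⟨V, hV, hEV⟩ := hchain.directedOn.exists_mem_subset_of_finite_of_subset_sUnion hne
        (hE.inter_of_right (⋃₀ C)) Set.inter_subset_left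
      obtain ⟨z, hz, hfz⟩ := hC hV ha hb f u y (by
        refine supported_mono hc hEV ?_
        rw [← cofanProj_comp, ← Category.assoc, hu, huE]) hy huy
      exact ⟨z, supported_mono hc (Set.subset_sUnion_of_mem hV) hz, hfz⟩
  let N (a : B) : AddSubgroup (a ⟶ Y) :=
    { carrier := {x | ∃ u : a ⟶ c.pt, u ≫ cofanProj hc U = u ∧ u ≫ Φ = x}
      zero_mem' := ⟨0, by simp, by simp⟩
      add_mem' := by
        rintro _ _ ⟨u, hu, rfl⟩ ⟨u', hu', rfl⟩
        exact ⟨u + u', by simp [hu, hu'], by simp⟩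
      neg_mem' := by
        rintro _ ⟨u, hu, rfl⟩
        exact ⟨-u, by simp [hu], by simp⟩ }
  have hN {a b : B} (f : a ⟶ b) {x : b ⟶ Y} (hx : x ∈ N b) : f ≫ x ∈ N a := by
    obtain ⟨u, hu, rfl⟩ := hx
    exact ⟨f ≫ u, by simp [hu], by simp⟩
  have hmem {a : B} (ha : IsFinitelyPresentable B a) (x : a ⟶ Y) (hx : x ≫ d = 0) : x ∈ N a := by
    by_contra hxN
    obtain ⟨i, x', u', hx', hux', hst⟩ := hS.exists_stable_summand hB hG d N hN ha x hx
    let i₁ : Idx := ⟨i, x', hx'⟩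
    have hiΦ : (c.inj i₁ : G i ⟶ c.pt) ≫ Φ = x' := inj_cofanDesc hc _ i₁
    have hi₁ : i₁ ∉ U := fun h => hxN (by
      have h1 : x' ∈ N (G i) := ⟨c.inj i₁, inj_cofanProj_of_mem hc h, hiΦ⟩
      have := add_mem hux' (hN u' h1)
      rwa [sub_add_cancel] at this)
    let j : G i ⟶ c.pt := c.inj i₁
    let π : c.pt ⟶ G i := cofanPi hc i₁
    have hjΦ : j ≫ Φ = x' := hiΦ
    have hjV : j ≫ cofanProj hc (insert i₁ U) = j :=
      inj_cofanProj_of_mem hc (Set.mem_insert i₁ U)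
    have hπj : cofanProj hc (insert i₁ U) = cofanProj hc U + π ≫ j := by
      rw [Set.insert_eq, Set.union_comm, cofanProj_union hc (by simpa using hi₁),
        cofanProj_singleton]
    refine hi₁ (hU.2 (y := insert i₁ U) ?_ (Set.subset_insert i₁ U) (Set.mem_insert i₁ U))
    intro a b ha hb f u y hu hy huy
    have hu' : u = u ≫ cofanProj hc U + (u ≫ π) ≫ j := by
      nth_rw 1 [← hu]
      rw [hπj, Preadditive.comp_add, Category.assoc]
    set u₁ := u ≫ cofanProj hc U with hu₁
    set u₂ : a ⟶ G i := u ≫ π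
    have huΦ : u ≫ Φ = u₁ ≫ Φ + u₂ ≫ x' :=
      (congrArg (· ≫ Φ) hu').trans <| (Preadditive.add_comp _ _ _ _ _ _).trans <|
        congrArg (u₁ ≫ Φ + ·) <| (Category.assoc _ _ _).trans (congrArg (u₂ ≫ ·) hjΦ)
    obtain ⟨z₁, hz₁, hkz₁⟩ := hU.1 ha (hb.biprod (hG.fp i)) (biprod.lift f (-u₂)) u₁
      (biprod.desc y x') (by simp [hu₁])
      (by refine biprod.hom_ext' _ _ ?_ ?_ <;> simp [hy, hx']) (by
        rw [biprod.lift_desc, ← huy, huΦ]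
        simp)
    obtain ⟨c', hc', α, w, hw, hαw, hkα⟩ := hd ha (hb.biprod (hG.fp i)) (biprod.lift f (-u₂))
      (biprod.desc y x' - z₁ ≫ Φ)
      (by
        rw [Preadditive.sub_comp, Category.assoc, hΦ, comp_zero, sub_zero]
        refine biprod.hom_ext' _ _ ?_ ?_ <;> simp [hy, hx']) (by
        rw [Preadditive.comp_sub, ← Category.assoc, hkz₁, biprod.lift_desc, ← huy, huΦ]
        simp)
    obtain ⟨l, hl⟩ := hst hc' (biprod.inr ≫ α) w hw (by
      refine ⟨biprod.inr ≫ z₁, by simp [hz₁], ?_⟩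
      rw [Category.assoc, Category.assoc, ← hαw]
      simp)
    have hk {W : B} (r : b ⊞ G i ⟶ W) :
        biprod.lift f (-u₂) ≫ r = f ≫ biprod.inl ≫ r - u₂ ≫ biprod.inr ≫ r := by
      rw [biprod.lift_eq]; simp [sub_eq_add_neg]
    rw [hk, sub_eq_zero] at hkα
    rw [hk, sub_eq_iff_eq_add] at hkz₁
    have hfz₂ : f ≫ biprod.inl ≫ α ≫ l = u₂ := by
      have := hkα =≫ l
      simp only [Category.assoc] at this hl
      rw [this, hl, Category.comp_id]
    refine ⟨biprod.inl ≫ z₁ - (biprod.inl ≫ α ≫ l) ≫ biprod.inr ≫ z₁ + (biprod.inl ≫ α ≫ l) ≫ j,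
      ?_, ?_⟩
    · have hz₁' := supported_mono hc (Set.subset_insert i₁ U) hz₁
      simp only [Preadditive.add_comp, Preadditive.sub_comp, Category.assoc, hz₁', hjV]
    · rw [Preadditive.comp_add, Preadditive.comp_sub, hkz₁, ← Category.assoc f, hfz₂,
        ← Category.assoc f, hfz₂, add_sub_cancel_right, ← hu']
  obtain ⟨c', ⟨hc'⟩⟩ := hB.exists_cofan fun i : U => G i.1.1
  refine ⟨U, fun i => i.1.1, c', hc', subcofanIncl c hc' ≫ Φ, by simp [hΦ], fun {b} hb x hx => ?_,
    fun {b} hb u hu => ?_⟩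
  · obtain ⟨u, hu, rfl⟩ := hmem hb x hx
    refine ⟨u ≫ subcofanProj hc U c', ?_⟩
    rw [← Category.assoc, Category.assoc u, subcofanProj_comp_subcofanIncl, hu]
  · obtain ⟨z, hz, hz'⟩ := hU.1 hb (isFinitelyPresentable_of_isZero (isZero_zero B))
      (0 : b ⟶ (0 : B))
      (u ≫ subcofanIncl c hc') 0 (by simp) (by simp) (by simp [hu])
    rw [zero_comp] at hz'
    have := hz'.symm =≫ subcofanProj hc U c'
    simpa using this

omit [HasZeroObject B] [HasBinaryBiproducts B] in
lemma IsFinitelyAccessible.isIso_of_bijective (hB : IsFinitelyAccessible B) {X Y : B} (φ : X ⟶ Y)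
    (h₁ : ∀ {b : B} (_ : IsFinitelyPresentable B b) (x : b ⟶ Y), ∃ u, u ≫ φ = x)
    (h₂ : ∀ {b : B} (_ : IsFinitelyPresentable B b) (u : b ⟶ X), u ≫ φ = 0 → u = 0) :
    IsIso φ := by
  obtain ⟨ι, G, hG, h⟩ := hB.2
  have hp {X : B} (p : FilteredColimitPresentation B X) (hp : ∀ j, p.D.obj j ∈ Set.range G)
    (j : p.J) : IsFinitelyPresentable B (p.D.obj j) := by
    obtain ⟨i, hi⟩ := hp j
    exact hi ▸ hG i
  obtain ⟨p, hpG⟩ := h Y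
  obtain ⟨p', hpG'⟩ := h X
  choose u hu using fun j => h₁ (hp p hpG j) (p.c.ι.app j ≫ p.iso.hom)
  have hinj {b : B} (hb : IsFinitelyPresentable B b) (u u' : b ⟶ X) (h : u ≫ φ = u' ≫ φ) :
      u = u' := by
    rw [← sub_eq_zero]
    exact h₂ hb _ (by rw [Preadditive.sub_comp, h, sub_self])
  have hnat {j k : p.J} (f : j ⟶ k) : p.D.map f ≫ u k = u j :=
    hinj (hp p hpG j) _ _ (by simp [hu, p.c.w_assoc])
  let s : Cocone p.D :=
    { pt := X
      ι := { app := u, naturality := fun j k f => (hnat f).trans (Category.comp_id _).symm } }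
  let ψ : Y ⟶ X := p.iso.inv ≫ p.hc.desc s
  have hψ : ψ ≫ φ = 𝟙 Y := by
    rw [← cancel_epi p.iso.hom]
    refine p.hc.hom_ext fun j => ?_
    simp [ψ, s, hu]
  refine ⟨ψ, ?_, hψ⟩
  rw [← cancel_epi p'.iso.hom]
  refine p'.hc.hom_ext fun j => ?_
  refine hinj (hp p' hpG' j) _ _ ?_
  simp [hψ]

omit [HasZeroObject B] [HasBinaryBiproducts B] in
lemma IsFinitelyAccessible.exists_fp_factor (hB : IsFinitelyAccessible B) {a b Y : B}
    (ha : IsFinitelyPresentable B a) (hb : IsFinitelyPresentable B b) (f : a ⟶ b) (x : b ⟶ Y)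
    (hfx : f ≫ x = 0) : ∃ (c : B) (_ : IsFinitelyPresentable B c) (α : b ⟶ c) (w : c ⟶ Y),
      x = α ≫ w ∧ f ≫ α = 0 := by
  obtain ⟨p, hp⟩ := hB.2.choose_spec.choose_spec.2 Y
  obtain ⟨j, y, hy⟩ := hb.exists_lift p.hc (x ≫ p.iso.inv)
  obtain ⟨k, t, ht⟩ := ha.exists_eq p.hc (f ≫ y) 0 (by
    rw [Category.assoc, hy, ← Category.assoc, hfx, zero_comp, zero_comp])
  refine ⟨p.D.obj k, ?_, y ≫ p.D.map t, p.c.ι.app k ≫ p.iso.hom, ?_, by simpa using ht⟩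
  · obtain ⟨i, hi⟩ := hp k
    exact hi ▸ hB.2.choose_spec.choose_spec.1 i
  · simp [reassoc_of% hy]

open ZeroObject in
/-- In a pure semisimple finitely accessible category, every object is a coproduct of finitely
presentable objects. -/
lemma IsPureSemisimple.exists_isColimit (hB : IsFinitelyAccessible B)
    (hS : IsPureSemisimple.{v} B) {ι : Type v} {G : ι → B} (hG : IsFpFamily G) (Y : B) :
    ∃ (I : Type v) (a : I → ι) (c : Cofan fun i => G (a i)), Nonempty (IsColimit c) ∧ c.pt = Y := by
  obtain ⟨I, a, c, hc, φ, -, h₁, h₂⟩ := hS.exists_fp_cover hB hG (0 : Y ⟶ (0 : B))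
    fun {a b} ha hb f x hx hfx => by
      obtain ⟨c, hc, α, w, hx, hf⟩ := hB.exists_fp_factor ha hb f x hfx
      exact ⟨c, hc, α, w, by simp, hx, hf⟩
  have := hB.isIso_of_bijective φ (fun hb x => h₁ hb x (by simp)) h₂
  exact ⟨I, a, Cofan.mk Y fun i => c.inj i ≫ φ, ⟨hc.ofIsoColimit (Cofan.ext (asIso φ))⟩, rfl⟩

end Structure

section HomotopyCategory

variable {B : Type u} [Category.{v} B] [Preadditive B]

/-- The quotient functor to the homotopy category of cochain complexes. -/
abbrev toK (B : Type u) [Category.{v} B] [Preadditive B] :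
    CochainComplex B ℤ ⥤ HomotopyCategory B (ComplexShape.up ℤ) :=
  HomotopyCategory.quotient B (ComplexShape.up ℤ)

lemma toK_map_eq_zero_iff {P Z : CochainComplex B ℤ} (f : P ⟶ Z) :
    (toK B).map f = 0 ↔ ∃ h : ∀ n : ℤ, P.X (n + 1) ⟶ Z.X n,
      ∀ n, f.f (n + 1) = P.d (n + 1) (n + 1 + 1) ≫ h (n + 1) + h n ≫ Z.d n (n + 1) := by
  rw [HomotopyCategory.quotient_map_eq_zero_iff]
  constructor
  · rintro ⟨H⟩
    refine ⟨fun n => H.hom (n + 1) n, fun n => ?_⟩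
    rw [H.comm (n + 1), dNext_eq (i' := n + 1 + 1) _ (by simp), prevD_eq (j' := n) _ (by simp)]
    simp
  · rintro ⟨h, hf⟩
    let k : ∀ i j, P.X i ⟶ Z.X j := fun i j =>
      if hij : j + 1 = i then eqToHom (by rw [hij]) ≫ h j else 0
    refine ⟨⟨k, fun i j hij => dif_neg hij, fun i => ?_⟩⟩
    obtain ⟨n, rfl⟩ : ∃ n, i = n + 1 := ⟨i - 1, by simp⟩
    rw [dNext_eq (i' := n + 1 + 1) _ (by simp), prevD_eq (j' := n) _ (by simp), hf]
    simp [k]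

lemma isZero_toK_obj_iff (Z : CochainComplex B ℤ) :
    IsZero ((toK B).obj Z) ↔ ∃ h : ∀ n : ℤ, Z.X (n + 1) ⟶ Z.X n,
      ∀ n, 𝟙 (Z.X (n + 1)) = Z.d (n + 1) (n + 1 + 1) ≫ h (n + 1) + h n ≫ Z.d n (n + 1) := by
  rw [IsZero.iff_id_eq_zero, ← CategoryTheory.Functor.map_id, toK_map_eq_zero_iff]
  rfl

section Coproducts

variable {I : Type v} {X : I → CochainComplex B ℤ} {c : Cofan X}

/-- A cofan of complexes in a given degree. -/
abbrev evalCofan (c : Cofan X) (n : ℤ) : Cofan fun i => (X i).X n :=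
  Cofan.mk (c.pt.X n) fun i => (c.inj i).f n

/-- A coproduct of complexes is a coproduct in each degree. -/
noncomputable def isColimitEvalCofan [HasCoproducts.{v} B] (hc : IsColimit c) (n : ℤ) :
    IsColimit (evalCofan c n) :=
  isColimitCofanMkObjOfIsColimit (HomologicalComplex.eval B (ComplexShape.up ℤ) n) X _
    (hc.ofIsoColimit (Cofan.ext (Iso.refl _)) : IsColimit (Cofan.mk c.pt c.inj))

/-- The image of a cofan of complexes in the homotopy category. -/
abbrev toKCofan (c : Cofan X) : Cofan fun i => (toK B).obj (X i) :=
  Cofan.mk ((toK B).obj c.pt) fun i => (toK B).map (c.inj i)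

lemma eval_cofanProj [HasCoproducts.{v} B] (hc : IsColimit c) (U : Set I) (n : ℤ) :
    (cofanProj hc U).f n = cofanProj (isColimitEvalCofan hc n) U := by
  refine cofan_hom_ext (isColimitEvalCofan hc n) fun i => ?_
  change (c.inj i ≫ cofanProj hc U).f n = _
  by_cases h : i ∈ U
  · rw [inj_cofanProj_of_mem hc h, inj_cofanProj_of_mem _ h]
    rfl
  · rw [inj_cofanProj_of_notMem hc h, inj_cofanProj_of_notMem _ h]
    rfl

/-- Coproducts of complexes are coproducts in the homotopy category. -/
lemma nonempty_isColimit_toKCofan [HasCoproducts.{v} B] (hc : IsColimit c) :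
    Nonempty (IsColimit (toKCofan c)) := by
  have hext {Z : CochainComplex B ℤ} (f : c.pt ⟶ Z)
      (hf : ∀ i, (toK B).map (c.inj i ≫ f) = 0) : (toK B).map f = 0 := by
    simp only [toK_map_eq_zero_iff] at hf ⊢
    choose h hh using hf
    let D (n : ℤ) : c.pt.X (n + 1) ⟶ Z.X n :=
      cofanDesc (isColimitEvalCofan hc (n + 1)) fun i => h i n
    have hD (i : I) (n : ℤ) : (c.inj i).f (n + 1) ≫ D n = h i n :=
      inj_cofanDesc (isColimitEvalCofan hc (n + 1)) _ i
    have hD' (i : I) (n : ℤ) : (c.inj i).f (n + 1) ≫ c.pt.d (n + 1) (n + 1 + 1) ≫ D (n + 1) =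
        (X i).d (n + 1) (n + 1 + 1) ≫ h i (n + 1) := by
      rw [← Category.assoc, (c.inj i).comm, Category.assoc, hD]
    have hfi (i : I) (n : ℤ) : (c.inj i).f (n + 1) ≫ f.f (n + 1) = (c.inj i).f (n + 1) ≫
        (c.pt.d (n + 1) (n + 1 + 1) ≫ D (n + 1) + D n ≫ Z.d n (n + 1)) := by
      refine (hh i n).trans ?_
      rw [Preadditive.comp_add, hD', ← Category.assoc _ (D n), hD]
    exact ⟨D, fun n => cofan_hom_ext (isColimitEvalCofan hc (n + 1)) fun i => hfi i n⟩
  have hext' {Z : CochainComplex B ℤ} (f g : c.pt ⟶ Z)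
      (hfg : ∀ i, (toK B).map (c.inj i) ≫ (toK B).map f = (toK B).map (c.inj i ≫ g)) :
      (toK B).map f = (toK B).map g := by
    rw [← sub_eq_zero, ← Functor.map_sub]
    refine hext _ fun i => ?_
    rw [Preadditive.comp_sub, Functor.map_sub, sub_eq_zero, ← hfg, Functor.map_comp]
  have hsurj {Y Z : CochainComplex B ℤ} (f : (toK B).obj Y ⟶ (toK B).obj Z) :
    ∃ g, (toK B).map g = f := (toK B).map_surjective f
  refine ⟨Cofan.IsColimit.mk _ (fun s => (toK B).map (cofanDesc hc fun i =>
    (hsurj (Z := s.pt.as) (s.inj i)).choose)) (fun s i => ?_) fun s m hm => ?_⟩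
  · refine ((toK B).map_comp _ _).symm.trans ?_
    rw [inj_cofanDesc]
    exact (hsurj (Z := s.pt.as) (s.inj i)).choose_spec
  · obtain ⟨g, rfl⟩ := hsurj (Z := s.pt.as) m
    refine hext' _ _ fun i => (hm i).trans ?_
    rw [inj_cofanDesc]
    exact (hsurj (Z := s.pt.as) (s.inj i)).choose_spec.symm

lemma exists_cofan_complex [HasCoproducts.{v} B] (X : I → CochainComplex B ℤ) :
    ∃ c : Cofan X, Nonempty (IsColimit c) :=
  ⟨_, ⟨coproductIsCoproduct X⟩⟩

lemma hasCoproducts_homotopyCategory [HasCoproducts.{v} B] :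
    HasCoproducts.{v} (HomotopyCategory B (ComplexShape.up ℤ)) := by
  refine fun I => ⟨fun F => ?_⟩
  obtain ⟨c, ⟨hc⟩⟩ := exists_cofan_complex fun i : I => (F.obj ⟨i⟩).as
  obtain ⟨hc'⟩ := nonempty_isColimit_toKCofan hc
  have : HasColimit (Discrete.functor fun i : I => (toK B).obj (F.obj ⟨i⟩).as) := ⟨⟨⟨_, hc'⟩⟩⟩
  exact hasColimit_of_iso (F := Discrete.functor fun i : I => (toK B).obj (F.obj ⟨i⟩).as)
    (Discrete.natIso fun _ => Iso.refl _)

end Coproducts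

end HomotopyCategory

section HomotopyCategory

open Cardinal

variable {B : Type u} [Category.{v} B] [Preadditive B]

lemma isKappaSmall_toK [HasCoproducts.{v} B] {κ : Cardinal.{v}} (P : CochainComplex B ℤ)
    (h : ∀ {I : Type v} {X : I → CochainComplex B ℤ} {c : Cofan X} (hc : IsColimit c)
      (f : P ⟶ c.pt), ∃ J : Set I, #J < κ ∧ (toK B).map f = (toK B).map (f ≫ cofanProj hc J)) :
    IsKappaSmall (HomotopyCategory B (ComplexShape.up ℤ)) Set.univ κ ((toK B).obj P) := by
  intro I X _ c hc f
  choose Y hY using fun i => HomotopyCategory.quotient_obj_surjective (X i)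
  obtain rfl : (fun i => (toK B).obj (Y i)) = X := funext hY
  obtain ⟨c₀, ⟨hc₀⟩⟩ := exists_cofan_complex Y
  obtain ⟨hk⟩ := nonempty_isColimit_toKCofan hc₀
  let e : c.pt ≅ (toK B).obj c₀.pt := hc.coconePointUniqueUpToIso hk
  obtain ⟨f₀, hf₀⟩ := (toK B).map_surjective (f ≫ e.hom)
  obtain ⟨J, hJ, hfJ⟩ := h hc₀ f₀
  obtain ⟨c', ⟨hc'⟩⟩ := exists_cofan_complex fun j : J => Y j
  obtain ⟨hk'⟩ := nonempty_isColimit_toKCofan hc'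
  refine ⟨J, toKCofan c', hk', (toK B).map (f₀ ≫ subcofanProj hc₀ J c'), hJ, ?_⟩
  have he : hk'.desc (Cofan.mk c.pt fun j : J => c.inj j.1) =
      (toK B).map (subcofanIncl c₀ hc') ≫ e.inv := by
    refine cofan_hom_ext hk' fun j => (hk'.fac _ _).trans ?_
    have h1 : (toK B).map (c'.inj j) ≫ (toK B).map (subcofanIncl c₀ hc') ≫ e.inv =
        (toK B).map (c₀.inj j.1) ≫ e.inv := by
      rw [← Category.assoc, ← Functor.map_comp, inj_subcofanIncl]
    exact (h1.trans (hc.comp_coconePointUniqueUpToIso_inv hk ⟨j.1⟩)).symm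
  rw [he, ← Category.assoc, ← Functor.map_comp, Category.assoc, subcofanProj_comp_subcofanIncl,
    ← hfJ, hf₀, Category.assoc, Iso.hom_inv_id, Category.comp_id]

lemma factorsThroughFamily_toK [HasCoproducts.{v} B]
    (S : Set (HomotopyCategory B (ComplexShape.up ℤ)))
    (P : CochainComplex B ℤ)
    (h : ∀ {I : Type v} {X : I → CochainComplex B ℤ} {c : Cofan X} (_ : IsColimit c)
      (f : P ⟶ c.pt), ∃ (Z : I → CochainComplex B ℤ) (_ : ∀ i, (toK B).obj (Z i) ∈ S)
        (φ : ∀ i, Z i ⟶ X i) (cz : Cofan Z) (hcz : IsColimit cz) (g : P ⟶ cz.pt),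
        (toK B).map f = (toK B).map (g ≫ cofanDesc hcz fun i => φ i ≫ c.inj i)) :
    FactorsThroughFamily (HomotopyCategory B (ComplexShape.up ℤ)) Set.univ S
      ((toK B).obj P) := by
  intro I X _ c hc f
  choose Y hY using fun i => HomotopyCategory.quotient_obj_surjective (X i)
  obtain rfl : (fun i => (toK B).obj (Y i)) = X := funext hY
  obtain ⟨c₀, ⟨hc₀⟩⟩ := exists_cofan_complex Y
  obtain ⟨hk⟩ := nonempty_isColimit_toKCofan hc₀
  let e : c.pt ≅ (toK B).obj c₀.pt := hc.coconePointUniqueUpToIso hk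
  obtain ⟨f₀, hf₀⟩ := (toK B).map_surjective (f ≫ e.hom)
  obtain ⟨Z, hZ, φ, cz, hcz, g, hg⟩ := h hc₀ f₀
  obtain ⟨hkz⟩ := nonempty_isColimit_toKCofan hcz
  refine ⟨fun i => (toK B).obj (Z i), hZ, fun i => (toK B).map (φ i), toKCofan cz, hkz,
    (toK B).map g, ?_⟩
  have he : hkz.desc (Cofan.mk c.pt fun i => (toK B).map (φ i) ≫ c.inj i) =
      (toK B).map (cofanDesc hcz fun i => φ i ≫ c₀.inj i) ≫ e.inv := by
    refine cofan_hom_ext hkz fun i => (hkz.fac _ _).trans ?_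
    have h1 : (toK B).map (cz.inj i) ≫
        (toK B).map (cofanDesc hcz fun i => φ i ≫ c₀.inj i) ≫ e.inv =
        (toK B).map (φ i) ≫ (toK B).map (c₀.inj i) ≫ e.inv := by
      rw [← Category.assoc, ← Functor.map_comp, inj_cofanDesc, Functor.map_comp, Category.assoc]
    have h2 : (toK B).map (c₀.inj i) ≫ e.inv = c.inj i :=
      hc.comp_coconePointUniqueUpToIso_inv hk ⟨i⟩
    exact (h1.trans (congrArg _ h2)).symm
  rw [he, ← Category.assoc, ← Functor.map_comp, ← hg, hf₀, Category.assoc, Iso.hom_inv_id,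
    Category.comp_id]

/-- Complexes with components in a given small family. -/
def complexesOver {κ : Type v} (E : κ → B) : Set (HomotopyCategory B (ComplexShape.up ℤ)) :=
  (toK B).obj '' {Y | ∀ n, Y.X n ∈ Set.range E}

lemma small_complexesOver {κ : Type v} (E : κ → B) : Small.{v} (complexesOver E) := by
  have : Small.{v} {Y : CochainComplex B ℤ | ∀ n, Y.X n ∈ Set.range E} := by
    let D : Type v := Σ k : ℤ → κ, {d : ∀ i j : ℤ, E (k i) ⟶ E (k j) //
      (∀ i j, ¬ (ComplexShape.up ℤ).Rel i j → d i j = 0) ∧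
      (∀ i j l, (ComplexShape.up ℤ).Rel i j → (ComplexShape.up ℤ).Rel j l → d i j ≫ d j l = 0)}
    let F (x : D) : {Y : CochainComplex B ℤ | ∀ n, Y.X n ∈ Set.range E} :=
      ⟨⟨fun n => E (x.1 n), x.2.1, x.2.2.1, x.2.2.2⟩, fun n => ⟨_, rfl⟩⟩
    refine small_of_surjective (f := F) ?_
    rintro ⟨⟨X, d, h₁, h₂⟩, hY⟩
    obtain ⟨k, hk⟩ : ∃ k : ℤ → κ, X = fun n => E (k n) :=
      ⟨fun n => (hY n).choose, funext fun n => (hY n).choose_spec.symm⟩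
    subst hk
    exact ⟨⟨k, d, h₁, h₂⟩, rfl⟩
  exact small_image _ _

/-- A complex can be modified up to isomorphism in each degree. -/
lemma exists_complex_of_iso (Y : CochainComplex B ℤ) {X : ℤ → B} (e : ∀ n, X n ≅ Y.X n) :
    ∃ Y' : CochainComplex B ℤ, (∀ n, Y'.X n = X n) ∧ Nonempty (Y' ≅ Y) :=
  ⟨{ X := X
     d := fun i j => (e i).hom ≫ Y.d i j ≫ (e j).inv
     shape := fun i j h => by simp [Y.shape i j h]
     d_comp_d' := fun i j k _ _ => by simp }, fun _ => rfl,
    ⟨HomologicalComplex.Hom.isoOfComponents e fun i j _ => by simp⟩⟩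

end HomotopyCategory

lemma exists_int_family {D : ℤ → Type*} (R : ∀ n, D n → D (n + 1) → Prop) (m : ℤ)
    (x₀ : ∀ n, D n) (h₀ : ∀ n < m, R n (x₀ n) (x₀ (n + 1)))
    (step : ∀ n, m ≤ n + 1 → ∀ z w, R n z w → ∃ u, R (n + 1) w u) :
    ∃ x : ∀ n, D n, (∀ n ≤ m, x n = x₀ n) ∧ ∀ n, R n (x n) (x (n + 1)) := by
  have h₁ (j : ℤ) (hj : m ≤ j) (x : ∀ n, D n) (hx : ∀ n < j, R n (x n) (x (n + 1))) :
      ∃ x' : ∀ n, D n, (∀ n ≤ j, x' n = x n) ∧ ∀ n < j + 1, R n (x' n) (x' (n + 1)) := by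
    obtain ⟨u, hu⟩ : ∃ u, R j (x j) u := by
      obtain ⟨n, rfl⟩ : ∃ n, j = n + 1 := ⟨j - 1, by simp⟩
      exact step n hj _ _ (hx n (by lia))
    have hne {n : ℤ} (hn : n ≤ j) : Function.update x (j + 1) u n = x n :=
      Function.update_of_ne (by lia) _ _
    refine ⟨Function.update x (j + 1) u, fun n hn => hne hn, fun n hn => ?_⟩
    rw [hne (by lia)]
    rcases (show n ≤ j by lia).eq_or_lt with rfl | hlt
    · rwa [Function.update_self]
    · rw [hne (by lia)]
      exact hx n hlt
  choose next hnext hnext' using h₁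
  let seq : ∀ k : ℕ, {x : ∀ n, D n // ∀ n < m + k, R n (x n) (x (n + 1))} := fun k =>
    Nat.rec ⟨x₀, by simpa using h₀⟩ (fun k x => ⟨next (m + k) (by lia) x.1 x.2, fun n hn =>
      hnext' (m + k) (by lia) x.1 x.2 n (by push_cast at hn; lia)⟩) k
  have hseq (k l : ℕ) (hkl : k ≤ l) (n : ℤ) (hn : n ≤ m + k) : (seq l).1 n = (seq k).1 n := by
    induction l, hkl using Nat.le_induction with
    | base => rfl
    | succ l hl ih =>
      rw [← ih]
      exact hnext (m + l) (by lia) (seq l).1 (seq l).2 n (by lia)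
  refine ⟨fun n => (seq (n - m).toNat).1 n, fun n hn => ?_, fun n => ?_⟩
  · exact hseq 0 _ (Nat.zero_le _) n (by simpa using hn)
  · dsimp only
    rw [← hseq (n - m).toNat (n + 1 - m).toNat (by lia) n (by lia)]
    exact (seq (n + 1 - m).toNat).2 n (by lia)

section WeakResolution

variable {B : Type u} [Category.{v} B] [Preadditive B]

/-- A complex of finitely presentable objects starting in degree `m`, and in which each
differential from degree `m + 1` on is a weak cokernel of the preceding one. -/
structure IsWeakResolution (m : ℤ) (Y : CochainComplex B ℤ) : Prop where
  fp : ∀ n, IsFinitelyPresentable B (Y.X n)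
  isZero : ∀ n < m, IsZero (Y.X n)
  exists_desc : ∀ n, m ≤ n → ∀ {W : B} (x : Y.X (n + 1) ⟶ W), Y.d n (n + 1) ≫ x = 0 →
    ∃ x', Y.d (n + 1) (n + 1 + 1) ≫ x' = x

namespace IsWeakResolution

variable {m : ℤ} {Y : CochainComplex B ℤ}

lemma of_iso (hY : IsWeakResolution m Y) {Y' : CochainComplex B ℤ} (e : Y' ≅ Y) :
    IsWeakResolution m Y' where
  fp n := (hY.fp n).of_retract (e.hom.f n) (e.inv.f n) (by simp [← HomologicalComplex.comp_f])
  isZero n hn := (hY.isZero n hn).of_iso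
    ((HomologicalComplex.eval B (ComplexShape.up ℤ) n).mapIso e)
  exists_desc n hn W x hx := by
    obtain ⟨x', hx'⟩ := hY.exists_desc n hn (e.inv.f (n + 1) ≫ x) (by
      rw [← Category.assoc, ← e.inv.comm, Category.assoc, hx, comp_zero])
    refine ⟨e.hom.f _ ≫ x', ?_⟩
    rw [← Category.assoc, ← e.hom.comm, Category.assoc, hx', ← Category.assoc,
      ← HomologicalComplex.comp_f]
    simp

lemma exists_hom (hY : IsWeakResolution m Y) {Z : CochainComplex B ℤ} (x : Y.X m ⟶ Z.X m)
    (y : Y.X (m + 1) ⟶ Z.X (m + 1)) (hxy : x ≫ Z.d m (m + 1) = Y.d m (m + 1) ≫ y) :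
    ∃ f : Y ⟶ Z, f.f m = x ∧ f.f (m + 1) = y := by
  obtain ⟨f, hf, hf'⟩ := exists_int_family (D := fun n => Y.X n ⟶ Z.X n)
    (fun n z w => z ≫ Z.d n (n + 1) = Y.d n (n + 1) ≫ w) (m + 1)
    (Function.update (Function.update 0 m x) (m + 1) y) (fun n hn => by
      by_cases h : n = m
      · subst h
        rw [Function.update_self, Function.update_of_ne (by lia), Function.update_self, hxy]
      · exact (hY.isZero n (by lia)).eq_of_src _ _)
    (fun n hn z w hzw => by
      obtain ⟨u, hu⟩ := hY.exists_desc n (by lia) (w ≫ Z.d (n + 1) (n + 1 + 1)) (by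
        rw [← Category.assoc, ← hzw]; simp)
      exact ⟨u, hu.symm⟩)
  have hcomm (i j : ℤ) (hij : (ComplexShape.up ℤ).Rel i j) : f i ≫ Z.d i j = Y.d i j ≫ f j := by
    obtain rfl : i + 1 = j := hij
    exact hf' i
  refine ⟨⟨f, hcomm⟩, (hf m (by lia)).trans ?_, (hf (m + 1) le_rfl).trans ?_⟩
  · rw [Function.update_of_ne (by lia), Function.update_self]
  · rw [Function.update_self]

lemma toK_map_eq_zero (hY : IsWeakResolution m Y) {Z : CochainComplex B ℤ} (f : Y ⟶ Z)
    (h₀ : f.f m = 0) (h₁ : f.f (m + 1) = 0) : (toK B).map f = 0 := by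
  obtain ⟨h, -, hh⟩ := exists_int_family (D := fun n => Y.X (n + 1) ⟶ Z.X n)
    (fun n z w => f.f (n + 1) = Y.d (n + 1) (n + 1 + 1) ≫ w + z ≫ Z.d n (n + 1)) (m + 1) 0
    (fun n hn => by
      simp only [Pi.zero_apply, comp_zero, zero_comp, add_zero]
      rcases (show n ≤ m by lia).eq_or_lt with rfl | h
      · exact h₁
      · rcases (show n + 1 ≤ m by lia).eq_or_lt with h | h
        · rw [h]; exact h₀
        · exact (hY.isZero _ h).eq_of_src _ _)
    (fun n hn z w hzw => by
      obtain ⟨u, hu⟩ := hY.exists_desc (n + 1) (by lia)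
        (f.f (n + 1 + 1) - w ≫ Z.d (n + 1) (n + 1 + 1)) (by
          rw [Preadditive.comp_sub, ← f.comm, hzw, Preadditive.add_comp]
          simp)
      exact ⟨u, by rw [hu]; simp⟩)
  exact (toK_map_eq_zero_iff f).2 ⟨h, hh⟩

end IsWeakResolution

lemma IsFinitelyAccessible.exists_weakCokernel (hB : IsFinitelyAccessible B)
    [HasProducts.{v} B] {ι : Type v} {G : ι → B} (hG : IsFpFamily G) {a b : B}
    (ha : IsFinitelyPresentable B a) (hb : IsFinitelyPresentable B b) (g : a ⟶ b) :
    ∃ (c : B) (_ : IsFinitelyPresentable B c) (k : b ⟶ c), g ≫ k = 0 ∧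
      ∀ {W : B} (x : b ⟶ W), g ≫ x = 0 → ∃ x', k ≫ x' = x := by
  let F (p : Σ i : ι, {h : b ⟶ G i // g ≫ h = 0}) : B := G p.1
  obtain ⟨c, hc, k, t, hk, hgk⟩ := hB.exists_fp_factor ha hb g (Pi.lift fun p => p.2.1 : b ⟶ ∏ᶜ F)
    (Pi.hom_ext _ _ fun p => by simp [p.2.2])
  refine ⟨c, hc, k, hgk, fun {W} x hx => ?_⟩
  obtain ⟨c', hc', y, w, rfl, hgy⟩ := hB.exists_fp_factor ha hb g x hx
  obtain ⟨i, ⟨e⟩⟩ := hG.exists_iso c' hc'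
  let p : Σ i : ι, {h : b ⟶ G i // g ≫ h = 0} := ⟨i, y ≫ e.hom, by simp [reassoc_of% hgy]⟩
  refine ⟨t ≫ Pi.π F p ≫ e.inv ≫ w, ?_⟩
  have h1 : k ≫ t ≫ Pi.π F p = y ≫ e.hom := by
    rw [← Category.assoc, ← hk]; simp [p]
  have h2 := h1 =≫ (e.inv ≫ w)
  simpa using h2

end WeakResolution

section

variable {B : Type u} [Category.{v} B] [Preadditive B] [HasZeroObject B]

lemma IsFinitelyAccessible.exists_weakResolution (hB : IsFinitelyAccessible B)
    [HasProducts.{v} B] {ι : Type v} {G : ι → B} (hG : IsFpFamily G) {a b : B}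
    (ha : IsFinitelyPresentable B a) (hb : IsFinitelyPresentable B b) (g : a ⟶ b) (m : ℤ) :
    ∃ (Y : CochainComplex B ℤ) (_ : IsWeakResolution m Y) (e : Y.X m ≅ a) (e' : Y.X (m + 1) ≅ b),
      Y.d m (m + 1) ≫ e'.hom = e.hom ≫ g := by
  have hw (s : Σ' (a b : B) (_ : a ⟶ b), IsFinitelyPresentable B a ∧ IsFinitelyPresentable B b) :=
    hB.exists_weakCokernel hG s.2.2.2.1 s.2.2.2.2 s.2.2.1
  choose c hc k hk hk' using hw
  let s : ℕ → Σ' (a b : B) (_ : a ⟶ b), IsFinitelyPresentable B a ∧ IsFinitelyPresentable B b :=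
    fun n => Nat.rec ⟨a, b, g, ha, hb⟩ (fun _ s => ⟨s.2.1, c s, k s, s.2.2.2.2, hc s⟩) n
  let d (n : ℕ) : (s n).1 ⟶ (s (n + 1)).1 := (s n).2.2.1
  let R : CochainComplex B ℕ := CochainComplex.of (fun n => (s n).1) d fun n => hk (s n)
  have hRd (n : ℕ) : R.d n (n + 1) = d n := by
    change CochainComplex.of.d _ d n (n + 1) = _
    simp [CochainComplex.of.d]
  let em := ComplexShape.embeddingUpIntGE m
  let Y : CochainComplex B ℤ := R.extend em
  let e (n : ℕ) (i : ℤ) (hi : m + n = i) : Y.X i ≅ R.X n := R.extendXIso em hi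
  have hd (n : ℕ) (i j : ℤ) (hi : m + n = i) (hj : m + (n + 1 : ℕ) = j) :
      Y.d i j = (e n i hi).hom ≫ R.d n (n + 1) ≫ (e (n + 1) j hj).inv := R.extend_d_eq em hi hj
  have hz (n : ℤ) (hn : n < m) : IsZero (Y.X n) :=
    R.isZero_extend_X em n fun i hi => by
      have : m + (i : ℤ) = n := hi
      lia
  refine ⟨Y, ⟨fun n => ?_, hz, fun n hn W x hx => ?_⟩, e 0 m (by simp), e 1 (m + 1) (by simp), ?_⟩
  · rcases lt_or_ge n m with h | h
    · exact isFinitelyPresentable_of_isZero (hz n h)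
    · obtain ⟨k, rfl⟩ := Int.le.dest h
      exact (s k).2.2.2.1.of_retract _ _ (e k (m + k) rfl).hom_inv_id
  · obtain ⟨i, rfl⟩ := Int.le.dest hn
    have h1 : (R.d i (i + 1)) ≫ (e (i + 1) (m + i + 1) (by push_cast; ring)).inv ≫ x = 0 := by
      rw [hd i _ _ rfl (by push_cast; ring)] at hx
      simpa using hx
    rw [hRd] at h1
    obtain ⟨x', hx'⟩ := hk' (s i) _ h1
    refine ⟨(e (i + 2) (m + i + 1 + 1) (by push_cast; ring)).hom ≫ x', ?_⟩
    have h2 : R.d (i + 1) (i + 1 + 1) ≫ x' =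
        (e (i + 1) (m + i + 1) (by push_cast; ring)).inv ≫ x := by
      rw [hRd]
      exact hx'
    rw [hd (i + 1) _ _ (by push_cast; ring) (by push_cast; ring)]
    simp [h2]
  · rw [hd 0 _ _ (by simp) (by simp), hRd]
    simp [d, s]

omit [HasZeroObject B] in
/-- A complex all of whose differentials have kernels, split by sections of the preceding
differentials, is contractible. -/
lemma isZero_toK_obj_of_kernels (Z : CochainComplex B ℤ) (C : ℤ → B) (j : ∀ n, C n ⟶ Z.X (n + 1))
    (hlift : ∀ n {W : B} (x : W ⟶ Z.X (n + 1)), x ≫ Z.d (n + 1) (n + 1 + 1) = 0 →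
      ∃ u, u ≫ j n = x)
    (hmono : ∀ n {W : B} (u : W ⟶ C n), u ≫ j n = 0 → u = 0)
    (s : ∀ n, C n ⟶ Z.X n) (hs : ∀ n, s n ≫ Z.d n (n + 1) = j n) :
    IsZero ((toK B).obj Z) := by
  choose d' hd' using fun n => hlift n (Z.d n (n + 1)) (by simp)
  choose r hr using fun n => hlift n (𝟙 (Z.X (n + 1)) - d' (n + 1) ≫ s (n + 1)) (by
    rw [Preadditive.sub_comp, Category.assoc, hs, hd']; simp)
  have hdd' (n : ℤ) : Z.d n (n + 1) ≫ d' (n + 1) = 0 := hmono _ _ (by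
    rw [Category.assoc, hd']; simp)
  have hdr (n : ℤ) : Z.d (n + 1) (n + 1 + 1) ≫ r (n + 1) = d' (n + 1) := by
    rw [← sub_eq_zero]
    refine hmono _ _ ?_
    rw [Preadditive.sub_comp, Category.assoc, hr, hd', Preadditive.comp_sub, ← Category.assoc,
      hdd']
    simp
  refine (isZero_toK_obj_iff Z).2 ⟨fun n => r n ≫ s n, fun n => ?_⟩
  rw [← Category.assoc, hdr, Category.assoc, hs, hr]
  simp

variable [HasBinaryBiproducts B]

/-- The condition that the maps from iterated weak cokernel complexes vanish. -/
lemma IsPureSemisimple.isZero_toK_obj (hB : IsFinitelyAccessible B)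
    (hS : IsPureSemisimple.{v} B) [HasProducts.{v} B] {ι : Type v} {G : ι → B} (hG : IsFpFamily G)
    (Z : CochainComplex B ℤ)
    (hZ : ∀ {a b : B} (_ : IsFinitelyPresentable B a) (_ : IsFinitelyPresentable B b) (g : a ⟶ b)
      (n : ℤ) (x : a ⟶ Z.X (n + 1)) (y : b ⟶ Z.X (n + 1 + 1)),
      x ≫ Z.d (n + 1) (n + 1 + 1) = g ≫ y →
      ∃ (s : a ⟶ Z.X n) (t : b ⟶ Z.X (n + 1)), x = s ≫ Z.d n (n + 1) + g ≫ t) :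
    IsZero ((toK B).obj Z) := by
  have key (n : ℤ) := hS.exists_fp_cover hB hG (Z.d (n + 1) (n + 1 + 1))
    fun {a b} ha hb f x hx hfx => by
      obtain ⟨c, hc, k, hfk, hk⟩ := hB.exists_weakCokernel hG ha hb f
      obtain ⟨x, rfl⟩ := hk x hfx
      obtain ⟨c', hc', k', hkk', hk'⟩ := hB.exists_weakCokernel hG hb hc k
      obtain ⟨y, hy⟩ := hk' (x ≫ Z.d _ (n + 1 + 1)) (by simpa using hx)
      obtain ⟨s, t, hst⟩ := hZ hc hc' k' n x y hy.symm
      exact ⟨c, hc, k, s ≫ Z.d n (n + 1), by simp, by rw [hst]; simp [reassoc_of% hkk'], hfk⟩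
  choose I a c hc j hj hlift hmono using key
  obtain ⟨z, hz⟩ : ∃ z : B, IsZero z := ⟨_, isZero_zero B⟩
  choose s _ hs using fun n (i : I n) => hZ (hG.fp (a n i)) (isFinitelyPresentable_of_isZero hz)
    0 n ((c n).inj i ≫ j n) 0 (by rw [Category.assoc, hj]; simp)
  refine isZero_toK_obj_of_kernels Z (fun n => (c n).pt) j (fun n W x hx => ?_)
    (fun n W u hu => ?_) (fun n => cofanDesc (hc n) (s n)) fun n => ?_
  · obtain ⟨I', a', c', ⟨hc'⟩, rfl⟩ := hS.exists_isColimit hB hG W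
    choose u hu using fun i => hlift n (hG.fp (a' i)) (c'.inj i ≫ x) (by
      rw [Category.assoc, hx, comp_zero])
    exact ⟨cofanDesc hc' u, cofan_hom_ext hc' fun i => by rw [inj_cofanDesc_assoc, hu]⟩
  · obtain ⟨I', a', c', ⟨hc'⟩, rfl⟩ := hS.exists_isColimit hB hG W
    refine cofan_hom_ext hc' fun i => ?_
    rw [comp_zero]
    exact hmono n (hG.fp (a' i)) _ (by rw [Category.assoc, hu, comp_zero])
  · refine cofan_hom_ext (hc n) fun i => ?_
    rw [inj_cofanDesc_assoc, hs]
    simp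

open scoped Classical in
lemma cofanProj_coe_finset {C : Type*} [Category* C] [Preadditive C] {I : Type*} {X : I → C}
    {c : Cofan X} (hc : IsColimit c) (J : Finset I) :
    cofanProj hc (J : Set I) = ∑ i ∈ J, cofanPi hc i ≫ c.inj i := by
  induction J using Finset.induction_on with
  | empty => simp [cofanProj_empty]
  | insert i J hi ih =>
    rw [Finset.sum_insert hi, Finset.coe_insert, Set.insert_eq,
      cofanProj_union hc (by simpa using hi), ih, cofanProj_singleton]

open Cardinal in
lemma IsPureSemisimple.isCompactlyGenerated (hB : IsFinitelyAccessible B)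
    (hS : IsPureSemisimple.{v} B) [HasProducts.{v} B] :
    IsCompactlyGeneratedSubcat (HomotopyCategory B (ComplexShape.up ℤ)) Set.univ := by
  have := hB.hasCoproducts
  obtain ⟨ι, G, hG₁, hG₂⟩ := hB.exists_fpSet
  have hG : IsFpFamily G := ⟨hG₁, fun a ha => hG₂ a ha⟩
  have hsupp {m : ℤ} {Y : CochainComplex B ℤ} (hY : IsWeakResolution m Y) {I : Type v}
      {X : I → CochainComplex B ℤ} {c : Cofan X} (hc : IsColimit c) (f : Y ⟶ c.pt) :
      ∃ J : Finset I, (toK B).map f = (toK B).map (f ≫ cofanProj hc J) := by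
    classical
    obtain ⟨E₀, hE₀, h₀⟩ := (hY.fp m).exists_finite_support hB (isColimitEvalCofan hc m) (f.f m)
    obtain ⟨E₁, hE₁, h₁⟩ := (hY.fp (m + 1)).exists_finite_support hB
      (isColimitEvalCofan hc (m + 1)) (f.f (m + 1))
    refine ⟨hE₀.toFinset ∪ hE₁.toFinset, ?_⟩
    have hsub₀ : E₀ ⊆ (hE₀.toFinset ∪ hE₁.toFinset : Finset I) := by simp
    have hsub₁ : E₁ ⊆ (hE₀.toFinset ∪ hE₁.toFinset : Finset I) := by simp
    rw [← sub_eq_zero, ← Functor.map_sub]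
    refine hY.toK_map_eq_zero _ ?_ ?_
    · rw [HomologicalComplex.sub_f_apply, HomologicalComplex.comp_f, eval_cofanProj, sub_eq_zero]
      exact (supported_mono (isColimitEvalCofan hc m) hsub₀ h₀).symm
    · rw [HomologicalComplex.sub_f_apply, HomologicalComplex.comp_f, eval_cofanProj, sub_eq_zero]
      exact (supported_mono (isColimitEvalCofan hc (m + 1)) hsub₁ h₁).symm
  refine ⟨isRegular_aleph0, (toK B).obj '' {Y | (∀ n, Y.X n ∈ Set.range G) ∧
    ∃ m, IsWeakResolution m Y}, Set.subset_univ _, ?_, ?_, ?_, ?_⟩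
  · have := small_complexesOver G
    have hsub : ((toK B).obj '' {Y | (∀ n, Y.X n ∈ Set.range G) ∧ ∃ m, IsWeakResolution m Y}) ⊆
        complexesOver G := by
      rintro _ ⟨Y, hY, rfl⟩
      exact ⟨Y, hY.1, rfl⟩
    exact small_subset hsub
  · intro Z _ hZ
    obtain ⟨Z, rfl⟩ := HomotopyCategory.quotient_obj_surjective Z
    refine hS.isZero_toK_obj hB hG Z fun {a b} ha hb g n x y hxy => ?_
    obtain ⟨Y, hY, e, e', hee⟩ := hB.exists_weakResolution hG ha hb g (n + 1)
    obtain ⟨f, hf, -⟩ := hY.exists_hom (e.hom ≫ x) (e'.hom ≫ y) (by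
      rw [Category.assoc, hxy, ← Category.assoc, ← hee, Category.assoc])
    choose k hk using fun n => hG.exists_iso _ (hY.fp n)
    obtain ⟨Y', hY', ⟨i⟩⟩ := exists_complex_of_iso Y fun n => (hk n).some.symm
    have h0 : (toK B).map (i.hom ≫ f) = 0 := hZ _ ⟨Y', ⟨fun n => ⟨k n, (hY' n).symm⟩, n + 1,
      hY.of_iso i⟩, rfl⟩ _
    have h1 : (toK B).map f = 0 := by
      have : f = i.inv ≫ i.hom ≫ f := by simp
      rw [this, Functor.map_comp, h0, comp_zero]
    obtain ⟨h, hh⟩ := (toK_map_eq_zero_iff f).1 h1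
    refine ⟨e.inv ≫ h n, e'.inv ≫ h (n + 1), ?_⟩
    have h2 := (hf.symm.trans (hh n))
    have h3 : e.inv ≫ Y.d (n + 1) (n + 1 + 1) = g ≫ e'.inv := by
      rw [Iso.inv_comp_eq, ← Category.assoc, ← hee]; simp
    rw [← Iso.eq_inv_comp] at h2
    rw [h2, Preadditive.comp_add, ← Category.assoc, h3]
    simp [add_comm]
  · rintro _ ⟨Y, ⟨-, m, hY⟩, rfl⟩
    refine isKappaSmall_toK Y fun hc f => ?_
    obtain ⟨J, hJ⟩ := hsupp hY hc f
    exact ⟨J, by simp, hJ⟩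
  · rintro _ ⟨Y, hY₀, rfl⟩
    have ⟨_, m, hY⟩ := hY₀
    apply factorsThroughFamily_toK
    intro I X c hc f
    obtain ⟨J, hJ⟩ := hsupp hY hc f
    obtain ⟨cz, ⟨hcz⟩⟩ := exists_cofan_complex fun _ : I => Y
    refine ⟨fun _ => Y, fun _ => ⟨Y, hY₀, rfl⟩, fun i => f ≫ cofanPi hc i, cz, hcz,
      ∑ i ∈ J, cz.inj i, hJ.trans ?_⟩
    congr 1
    rw [cofanProj_coe_finset, Preadditive.comp_sum, Preadditive.sum_comp]
    exact Finset.sum_congr rfl fun i _ => by rw [inj_cofanDesc, Category.assoc]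

end

section

variable {B : Type u} [Category.{v} B] [Preadditive B]

lemma exists_countable_closed {A : Type*} (T : A → Set A) (hT : ∀ x, (T x).Countable)
    {U₀ : Set A} (hU₀ : U₀.Countable) :
    ∃ U : Set A, U₀ ⊆ U ∧ U.Countable ∧ ∀ x ∈ U, T x ⊆ U := by
  let W (n : ℕ) : Set A := Nat.rec U₀ (fun _ W => ⋃ x ∈ W, T x) n
  have hW (n : ℕ) : (W n).Countable := by
    induction n with
    | zero => exact hU₀
    | succ n ih => exact ih.biUnion fun x _ => hT x
  refine ⟨⋃ n, W n, Set.subset_iUnion W 0, Set.countable_iUnion hW, fun x hx => ?_⟩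
  obtain ⟨n, hn⟩ := Set.mem_iUnion.1 hx
  exact (Set.subset_biUnion_of_mem (u := T) hn).trans (Set.subset_iUnion W (n + 1))

/-- Representatives of the countable coproducts of members of a family of objects. -/
noncomputable def countableCoproduct [HasCoproducts.{v} B] {ι : Type v} (G : ι → B)
    (k : Σ D : Set (ULift.{v} ℕ), (D → ι)) : B :=
  ∐ fun i : k.1 => G (k.2 i)

omit [Preadditive B] in
lemma exists_countableCoproduct_iso [HasCoproducts.{v} B] {ι : Type v} (G : ι → B) {I : Type v}
    [Countable I] (a : I → ι) :
    ∃ (k : _) (c : Cofan fun i => G (a i)), Nonempty (IsColimit c) ∧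
      c.pt = countableCoproduct G k := by
  obtain ⟨f, hf⟩ := Countable.exists_injective_nat I
  let e : I ≃ Set.range fun i => ULift.up.{v} (f i) :=
    Equiv.ofInjective _ (ULift.up_injective.comp hf)
  obtain ⟨a, rfl⟩ : ∃ a' : (Set.range fun i => ULift.up.{v} (f i)) → ι, a = a' ∘ e :=
    ⟨a ∘ e.symm, by ext; simp⟩
  have hc := coproductIsCoproduct fun x => G (a x)
  have hs {Z : B} (s : ∀ i, G (a (e i)) ⟶ Z) (x : I) (y : I) (h : x = y) :
      eqToHom (by rw [h]) ≫ s x = s y := by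
    subst h
    simp
  refine ⟨⟨_, a⟩, Cofan.mk (∐ fun x => G (a x)) fun i => Sigma.ι (fun x => G (a x)) (e i),
    ⟨Cofan.IsColimit.mk _ (fun s => Sigma.desc fun x =>
      eqToHom (by simp) ≫ s.inj (e.symm x)) (fun s i => ?_) fun s m hm => ?_⟩, rfl⟩
  · refine (colimit.ι_desc _ _).trans ?_
    exact hs s.inj _ i (by simp)
  · refine cofan_hom_ext hc fun x => ?_
    obtain ⟨i, rfl⟩ := e.surjective x
    refine (hm i).trans ((hs s.inj (e.symm (e i)) i (e.symm_apply_apply i)).symm.trans ?_)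
    symm
    apply Sigma.ι_desc

/-- A decomposition of an object as a coproduct of finitely presentable objects, whose countable
subcoproducts are isomorphic to members of the family `E`. -/
structure FpDecomposition {κ : Type v} (E : κ → B) (Y : B) where
  /-- The index set. -/
  J : Type v
  /-- The summands. -/
  a : J → B
  fp : ∀ j, IsFinitelyPresentable B (a j)
  /-- The inclusions. -/
  inj : ∀ j, a j ⟶ Y
  /-- The projections onto subcoproducts. -/
  p : Set J → (Y ⟶ Y)
  hom_ext : ∀ {W : B} {f g : Y ⟶ W}, (∀ j, inj j ≫ f = inj j ≫ g) → f = g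
  exists_desc : ∀ {W : B} (f : ∀ j, a j ⟶ W), ∃ g : Y ⟶ W, ∀ j, inj j ≫ g = f j
  inj_p_of_mem : ∀ {U : Set J} {j : J}, j ∈ U → inj j ≫ p U = inj j
  inj_p_of_notMem : ∀ {U : Set J} {j : J}, j ∉ U → inj j ≫ p U = 0
  exists_support : ∀ {b : B}, IsFinitelyPresentable B b → ∀ f : b ⟶ Y,
    ∃ U : Set J, U.Finite ∧ f ≫ p U = f
  exists_split : ∀ {U : Set J}, U.Countable →
    ∃ (k : κ) (s : E k ⟶ Y) (r : Y ⟶ E k), s ≫ r = 𝟙 _ ∧ r ≫ s = p U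

namespace FpDecomposition

variable {κ : Type v} {E : κ → B} {Y : B} (D : FpDecomposition E Y)

lemma p_comp_of_subset {U V : Set D.J} (h : U ⊆ V) : D.p U ≫ D.p V = D.p U :=
  D.hom_ext fun j => by
    by_cases hj : j ∈ U
    · rw [← Category.assoc, D.inj_p_of_mem hj, D.inj_p_of_mem (h hj)]
    · rw [← Category.assoc, D.inj_p_of_notMem hj, zero_comp]

lemma supported_mono {W : B} {f : W ⟶ Y} {U V : Set D.J} (h : U ⊆ V)
    (hf : f ≫ D.p U = f) : f ≫ D.p V = f := by
  rw [← hf, Category.assoc, D.p_comp_of_subset h]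

lemma inj_p_of_mem_assoc {U : Set D.J} {j : D.J} (h : j ∈ U) {W : B} (f : Y ⟶ W) :
    D.inj j ≫ D.p U ≫ f = D.inj j ≫ f := by
  rw [← Category.assoc, D.inj_p_of_mem h]

lemma inj_p_of_notMem_assoc {U : Set D.J} {j : D.J} (h : j ∉ U) {W : B} (f : Y ⟶ W) :
    D.inj j ≫ D.p U ≫ f = 0 := by
  rw [← Category.assoc, D.inj_p_of_notMem h, zero_comp]

lemma p_comp_eq_zero {U : Set D.J} {W : B} {f : Y ⟶ W} (h : ∀ j ∈ U, D.inj j ≫ f = 0) :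
    D.p U ≫ f = 0 :=
  D.hom_ext fun j => by
    by_cases hj : j ∈ U
    · rw [D.inj_p_of_mem_assoc hj, h j hj, comp_zero]
    · rw [D.inj_p_of_notMem_assoc hj, comp_zero]

lemma p_comp_eq {U V : Set D.J} {W : B} {f : Y ⟶ W} (h : ∀ j ∈ V, D.inj j ≫ f = 0) :
    D.p (U \ V) ≫ f = D.p U ≫ f :=
  D.hom_ext fun j => by
    by_cases hj : j ∈ U
    · by_cases hV : j ∈ V
      · rw [D.inj_p_of_mem_assoc hj, h j hV, D.inj_p_of_notMem_assoc (U := U \ V) (fun h => h.2 hV)]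
      · rw [D.inj_p_of_mem_assoc hj, D.inj_p_of_mem_assoc (U := U \ V) ⟨hj, hV⟩]
    · rw [D.inj_p_of_notMem_assoc hj, D.inj_p_of_notMem_assoc (U := U \ V) (fun h => hj h.1)]

end FpDecomposition

/-- The decompositions whose countable subcoproducts are countable coproducts of members of a
family of representatives of the finitely presentable objects. -/
lemma IsPureSemisimple.nonempty_fpDecomposition [HasZeroObject B] [HasBinaryBiproducts B]
    [HasCoproducts.{v} B] (hB : IsFinitelyAccessible B) (hS : IsPureSemisimple.{v} B)
    {ι : Type v} {G : ι → B} (hG : IsFpFamily G) (Y : B) :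
    Nonempty (FpDecomposition (countableCoproduct G) Y) := by
  obtain ⟨J, a, c, ⟨hc⟩, rfl⟩ := hS.exists_isColimit hB hG Y
  exact ⟨{
    J := J
    a := fun j => G (a j)
    fp := fun j => hG.fp _
    inj := c.inj
    p := cofanProj hc
    hom_ext := cofan_hom_ext hc
    exists_desc := fun f => ⟨cofanDesc hc f, inj_cofanDesc hc f⟩
    inj_p_of_mem := inj_cofanProj_of_mem hc
    inj_p_of_notMem := inj_cofanProj_of_notMem hc
    exists_support := fun hb f => hb.exists_finite_support hB hc f
    exists_split := fun {U} hU => by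
      have := hU.to_subtype
      obtain ⟨k, c', ⟨hc'⟩, hk⟩ := exists_countableCoproduct_iso G fun i : U => a i
      exact ⟨k, eqToHom hk.symm ≫ subcofanIncl c hc', subcofanProj hc U c' ≫ eqToHom hk,
        by simp [← Category.assoc (subcofanIncl c hc')], by simp⟩ }⟩

omit [Preadditive B] in
lemma exists_countable_support [HasCoproducts.{v} B] {ι : Type v} {G : ι → B}
    (hG : ∀ i, IsFinitelyPresentable B (G i)) {J : Type v} {Y : B} (p : Set J → (Y ⟶ Y))
    (hp : ∀ {U V : Set J}, U ⊆ V → p U ≫ p V = p U)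
    (hfin : ∀ {b : B}, IsFinitelyPresentable B b → ∀ f : b ⟶ Y, ∃ U : Set J, U.Finite ∧ f ≫ p U = f)
    {P : B} (hP : P ∈ Set.range (countableCoproduct G)) (f : P ⟶ Y) :
    ∃ U : Set J, U.Countable ∧ f ≫ p U = f := by
  have key {I : Type v} [Countable I] {a : I → B} (ha : ∀ i, IsFinitelyPresentable B (a i))
      {c : Cofan a} (hc : IsColimit c) (f : c.pt ⟶ Y) : ∃ U : Set J, U.Countable ∧ f ≫ p U = f := by
    choose U hU hfU using fun i => hfin (ha i) (c.inj i ≫ f)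
    refine ⟨⋃ i, U i, Set.countable_iUnion fun i => (hU i).countable, cofan_hom_ext hc fun i => ?_⟩
    rw [← Category.assoc, ← hfU, Category.assoc, hp (Set.subset_iUnion U i)]
  obtain ⟨k, rfl⟩ := hP
  exact key (fun i => hG (k.2 i)) (coproductIsCoproduct fun i : k.1 => G (k.2 i)) f

/-- A complex assembled from summands of the components of a complex. -/
lemma exists_complex_of_split {κ : Type v} {E : κ → B} (Z : CochainComplex B ℤ)
    (q : ∀ n, Z.X n ⟶ Z.X n)
    (hq : ∀ n, ∃ (k : κ) (s : E k ⟶ Z.X n) (r : Z.X n ⟶ E k), s ≫ r = 𝟙 _ ∧ r ≫ s = q n)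
    (h : ∀ i j k, q i ≫ Z.d i j ≫ q j ≫ Z.d j k ≫ q k = 0) :
    ∃ (Q : CochainComplex B ℤ) (_ : ∀ n, Q.X n ∈ Set.range E) (s : ∀ n, Q.X n ⟶ Z.X n)
      (r : ∀ n, Z.X n ⟶ Q.X n), (∀ n, s n ≫ r n = 𝟙 _) ∧ (∀ n, r n ≫ s n = q n) ∧
        ∀ i j, Q.d i j = s i ≫ Z.d i j ≫ r j := by
  choose k s r hsr hrs using hq
  refine ⟨{
    X := fun n => E (k n)
    d := fun i j => s i ≫ Z.d i j ≫ r j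
    shape := fun i j hij => by simp [Z.shape i j hij]
    d_comp_d' := fun i j l _ _ => ?_ }, fun n => ⟨k n, rfl⟩, s, r, hsr, hrs, fun _ _ => rfl⟩
  have := h i j l
  rw [← hrs i, ← hrs j, ← hrs l] at this
  simpa [hsr, reassoc_of% hsr] using s i ≫= this =≫ r l

lemma exists_hom_nullhomotopic {P Z : CochainComplex B ℤ} (h : ∀ n : ℤ, P.X (n + 1) ⟶ Z.X n) :
    ∃ φ : P ⟶ Z, ∀ n, φ.f (n + 1) =
      P.d (n + 1) (n + 1 + 1) ≫ h (n + 1) + h n ≫ Z.d n (n + 1) := by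
  let k : ∀ i j, (ComplexShape.up ℤ).Rel j i → (P.X i ⟶ Z.X j) := fun i j hij =>
    eqToHom (congrArg P.X hij.symm) ≫ h j
  refine ⟨Homotopy.nullHomotopicMap' k, fun n => ?_⟩
  rw [Homotopy.nullHomotopicMap'_f (k₂ := n) (k₁ := n + 1) (k₀ := n + 1 + 1) (by simp) (by simp)]
  simp [k]

end

section

variable {B : Type u} [Category.{v} B] [Preadditive B] {κ : Type v} {E : κ → B}

/-- The summands in a given degree. -/
abbrev degreePart {Z : CochainComplex B ℤ} (D : ∀ n, FpDecomposition E (Z.X n))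
    (V : Set (Σ n, (D n).J)) (n : ℤ) : Set (D n).J :=
  {j | ⟨n, j⟩ ∈ V}

/-- A contraction of a complex on a part of its summands. -/
structure PartialContraction (Z : CochainComplex B ℤ) (D : ∀ n, FpDecomposition E (Z.X n))
    (T : (Σ n, (D n).J) → Set (Σ n, (D n).J)) where
  /-- The set of summands. -/
  V : Set (Σ n, (D n).J)
  /-- The contraction. -/
  h : ∀ n : ℤ, Z.X (n + 1) ⟶ Z.X n
  closed : ∀ x ∈ V, T x ⊆ V
  supp : ∀ n, (D (n + 1)).p (degreePart D V (n + 1)) ≫ h n = h n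
  contr : ∀ n (j : (D (n + 1)).J), ⟨n + 1, j⟩ ∈ V →
    (D (n + 1)).inj j ≫ (Z.d (n + 1) (n + 1 + 1) ≫ h (n + 1) + h n ≫ Z.d n (n + 1)) =
      (D (n + 1)).inj j

variable (Z : CochainComplex B ℤ) (D : ∀ n, FpDecomposition E (Z.X n))

lemma exists_support_d : ∃ T : (Σ n, (D n).J) → Set (Σ n, (D n).J), (∀ x, (T x).Countable) ∧
    ∀ (V : Set (Σ n, (D n).J)), (∀ x ∈ V, T x ⊆ V) → ∀ (n : ℤ) (j : (D n).J), ⟨n, j⟩ ∈ V →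
      (D n).inj j ≫ Z.d n (n + 1) ≫ (D (n + 1)).p (degreePart D V (n + 1)) =
        (D n).inj j ≫ Z.d n (n + 1) := by
  choose U hU hU' using fun x : Σ n, (D n).J => (D (x.1 + 1)).exists_support ((D x.1).fp x.2)
    ((D x.1).inj x.2 ≫ Z.d x.1 (x.1 + 1))
  refine ⟨fun x => Sigma.mk (x.1 + 1) '' U x, fun x => (hU x).countable.image _,
    fun V hV n j hj => ?_⟩
  have := (D (n + 1)).supported_mono (Set.image_subset_iff.1 (hV _ hj)) (hU' ⟨n, j⟩)
  rwa [Category.assoc] at this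

variable {Z D}

lemma PartialContraction.exists_chain_bound {T : (Σ n, (D n).J) → Set (Σ n, (D n).J)}
    (hT : ∀ (V : Set (Σ n, (D n).J)), (∀ x ∈ V, T x ⊆ V) → ∀ (n : ℤ) (j : (D n).J), ⟨n, j⟩ ∈ V →
      (D n).inj j ≫ Z.d n (n + 1) ≫ (D (n + 1)).p (degreePart D V (n + 1)) =
        (D n).inj j ≫ Z.d n (n + 1))
    (c : Set (PartialContraction Z D T)) (hc : IsChain (fun P Q => P.V ⊆ Q.V ∧
      ∀ n, (D (n + 1)).p (degreePart D P.V (n + 1)) ≫ Q.h n = P.h n) c) :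
    ∃ Q : PartialContraction Z D T, ∀ P ∈ c, P.V ⊆ Q.V ∧
      ∀ n, (D (n + 1)).p (degreePart D P.V (n + 1)) ≫ Q.h n = P.h n := by
  classical
  let V : Set (Σ n, (D n).J) := ⋃ P ∈ c, P.V
  have hV {x} : x ∈ V ↔ ∃ P ∈ c, x ∈ P.V := by simp [V]
  have hcl : ∀ x ∈ V, T x ⊆ V := fun x hx => by
    obtain ⟨P, hP, hx⟩ := hV.1 hx
    exact fun y hy => hV.2 ⟨P, hP, P.closed x hx hy⟩
  choose h hh using fun n : ℤ => (D (n + 1)).exists_desc (W := Z.X n) fun j =>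
    if hj : (⟨n + 1, j⟩ : Σ n, (D n).J) ∈ V then
      (D (n + 1)).inj j ≫ (hV.1 hj).choose.h n else 0
  have hinj (P : PartialContraction Z D T) (hP : P ∈ c) (n : ℤ) (j : (D (n + 1)).J)
      (hj : ⟨n + 1, j⟩ ∈ P.V) : (D (n + 1)).inj j ≫ h n = (D (n + 1)).inj j ≫ P.h n := by
    have hjV : (⟨n + 1, j⟩ : Σ n, (D n).J) ∈ V := hV.2 ⟨P, hP, hj⟩
    rw [hh, dif_pos hjV]
    obtain ⟨hQ, hjQ⟩ := (hV.1 hjV).choose_spec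
    generalize (hV.1 hjV).choose = Q at hQ hjQ
    by_cases hPQ : P = Q
    · rw [hPQ]
    · rcases hc hP hQ hPQ with ⟨-, h⟩ | ⟨-, h⟩
      · rw [← h, (D (n + 1)).inj_p_of_mem_assoc (by exact hj)]
      · rw [← h, (D (n + 1)).inj_p_of_mem_assoc (by exact hjQ)]
  have hres (P : PartialContraction Z D T) (hP : P ∈ c) (n : ℤ) :
      (D (n + 1)).p (degreePart D P.V (n + 1)) ≫ h n = P.h n :=
    (D (n + 1)).hom_ext fun j => by
      by_cases hj : ⟨n + 1, j⟩ ∈ P.V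
      · rw [(D (n + 1)).inj_p_of_mem_assoc (by exact hj), hinj P hP n j hj]
      · rw [← P.supp, (D (n + 1)).inj_p_of_notMem_assoc (by exact hj),
          (D (n + 1)).inj_p_of_notMem_assoc (by exact hj)]
  refine ⟨⟨V, h, hcl, fun n => (D (n + 1)).hom_ext fun j => ?_, fun n j hj => ?_⟩,
    fun P hP => ⟨fun x hx => hV.2 ⟨P, hP, hx⟩, hres P hP⟩⟩
  · by_cases hj : (⟨n + 1, j⟩ : Σ n, (D n).J) ∈ V
    · rw [(D (n + 1)).inj_p_of_mem_assoc (by exact hj)]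
    · rw [(D (n + 1)).inj_p_of_notMem_assoc (by exact hj), hh, dif_neg hj]
  · obtain ⟨P, hP, hjP⟩ := hV.1 hj
    have h₁ : (D (n + 1)).inj j ≫ Z.d (n + 1) (n + 1 + 1) ≫ h (n + 1) =
        (D (n + 1)).inj j ≫ Z.d (n + 1) (n + 1 + 1) ≫ P.h (n + 1) := by
      have := hT P.V P.closed (n + 1) j hjP =≫ h (n + 1)
      simp only [Category.assoc, hres P hP] at this
      exact this.symm
    have h₂ := hinj P hP n j hjP =≫ Z.d n (n + 1)
    simp only [Category.assoc] at h₂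
    rw [Preadditive.comp_add, h₁, h₂, ← Preadditive.comp_add, P.contr n j hjP]

lemma PartialContraction.exists_extension {T : (Σ n, (D n).J) → Set (Σ n, (D n).J)}
    (hTc : ∀ x, (T x).Countable)
    (hT : ∀ (V : Set (Σ n, (D n).J)), (∀ x ∈ V, T x ⊆ V) → ∀ (n : ℤ) (j : (D n).J), ⟨n, j⟩ ∈ V →
      (D n).inj j ≫ Z.d n (n + 1) ≫ (D (n + 1)).p (degreePart D V (n + 1)) =
        (D n).inj j ≫ Z.d n (n + 1))
    (hZ : ∀ Q : CochainComplex B ℤ, (∀ n, Q.X n ∈ Set.range E) → ∀ f : Q ⟶ Z, (toK B).map f = 0)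
    (P : PartialContraction Z D T) (x₀ : Σ n, (D n).J) :
    ∃ Q : PartialContraction Z D T, (P.V ⊆ Q.V ∧
      ∀ n, (D (n + 1)).p (degreePart D P.V (n + 1)) ≫ Q.h n = P.h n) ∧ x₀ ∈ Q.V := by
  obtain ⟨W, hxW, hWc, hW⟩ := exists_countable_closed T hTc (Set.countable_singleton x₀)
  obtain ⟨φ, hφ⟩ := exists_hom_nullhomotopic P.h
  let u : Z ⟶ Z := 𝟙 Z - φ
  have hu {n : ℤ} {j : (D n).J} (hj : ⟨n, j⟩ ∈ P.V) : (D n).inj j ≫ u.f n = 0 := by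
    obtain ⟨n, rfl⟩ : ∃ m, n = m + 1 := ⟨n - 1, by simp⟩
    have := P.contr n j hj
    rw [← hφ] at this
    simp [u, this]
  let q (n : ℤ) : Z.X n ⟶ Z.X n := (D n).p (degreePart D W n \ degreePart D P.V n)
  have hq_mem {n : ℤ} {j : (D n).J} (hj : ⟨n, j⟩ ∈ W) (hj' : ⟨n, j⟩ ∉ P.V) :
      (D n).inj j ≫ q n = (D n).inj j := (D n).inj_p_of_mem ⟨hj, hj'⟩
  have hq_notMem {n : ℤ} {j : (D n).J} (hj : ⟨n, j⟩ ∉ W) : (D n).inj j ≫ q n = 0 :=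
    (D n).inj_p_of_notMem fun h => hj h.1
  have hq_notMem' {n : ℤ} {j : (D n).J} (hj : ⟨n, j⟩ ∈ P.V) : (D n).inj j ≫ q n = 0 :=
    (D n).inj_p_of_notMem fun h => h.2 hj
  have hqd {n : ℤ} {X : B} {g : Z.X (n + 1) ⟶ X}
      (hg : ∀ j, ⟨n + 1, j⟩ ∈ P.V → (D (n + 1)).inj j ≫ g = 0) :
      q n ≫ Z.d n (n + 1) ≫ q (n + 1) ≫ g = q n ≫ Z.d n (n + 1) ≫ g := by
    have h1 : q (n + 1) ≫ g = (D (n + 1)).p (degreePart D W (n + 1)) ≫ g := (D _).p_comp_eq hg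
    refine (D n).hom_ext fun j => ?_
    by_cases hj : ⟨n, j⟩ ∈ W
    · by_cases hj' : ⟨n, j⟩ ∈ P.V
      · rw [← Category.assoc, hq_notMem' hj', zero_comp, ← Category.assoc, hq_notMem' hj',
          zero_comp]
      · rw [h1, ← Category.assoc, ← Category.assoc _ (q n), hq_mem hj hj']
        simpa using hT W hW n j hj =≫ g
    · rw [← Category.assoc, hq_notMem hj, zero_comp, ← Category.assoc, hq_notMem hj, zero_comp]
  have hqdq {n : ℤ} {j : (D n).J} (hj : ⟨n, j⟩ ∈ P.V) :
      (D n).inj j ≫ Z.d n (n + 1) ≫ q (n + 1) = 0 := by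
    have h1 : (D (n + 1)).p (degreePart D P.V (n + 1)) ≫ q (n + 1) = 0 :=
      (D _).p_comp_eq_zero fun j hj => hq_notMem' hj
    have h2 := hT P.V P.closed n j hj =≫ q (n + 1)
    simp only [Category.assoc, h1, comp_zero] at h2
    exact h2.symm
  obtain ⟨Q, hQ, s, r, hsr, hrs, hd⟩ := exists_complex_of_split Z q
    (fun n => (D n).exists_split ((hWc.preimage sigma_mk_injective).mono Set.sdiff_subset))
    fun i j k => by
      by_cases hij : i + 1 = j
      · by_cases hjk : j + 1 = k
        · subst hij hjk
          rw [hqd fun j hj => hqdq hj]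
          simp
        · simp [Z.shape j k hjk]
      · simp [Z.shape i j hij]
  have hqu (n : ℤ) : q n ≫ Z.d n (n + 1) ≫ q (n + 1) ≫ u.f (n + 1) =
      q n ≫ Z.d n (n + 1) ≫ u.f (n + 1) := hqd fun j hj => hu hj
  have hsq (n : ℤ) : s n ≫ q n = s n := by rw [← hrs, ← Category.assoc, hsr, Category.id_comp]
  have hqr (n : ℤ) : q n ≫ r n = r n := by rw [← hrs, Category.assoc, hsr, Category.comp_id]
  let f : Q ⟶ Z :=
    { f := fun n => s n ≫ u.f n
      comm' := fun i j hij => by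
        obtain rfl : i + 1 = j := hij
        rw [hd, Category.assoc, Category.assoc, Category.assoc, ← Category.assoc (r _), hrs,
          ← hsq, Category.assoc, Category.assoc, hqu, ← u.comm] }
  obtain ⟨k, hk⟩ := (toK_map_eq_zero_iff f).1 (hZ Q hQ f)
  have hr {n : ℤ} {j : (D n).J} (hj : ⟨n, j⟩ ∈ P.V) : (D n).inj j ≫ r n = 0 := by
    rw [← hqr, ← Category.assoc, hq_notMem' hj, zero_comp]
  have hr' {n : ℤ} {j : (D n).J} (hj : ⟨n, j⟩ ∉ W) : (D n).inj j ≫ r n = 0 := by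
    rw [← hqr, ← Category.assoc, hq_notMem hj, zero_comp]
  have hres (n : ℤ) (j : (D (n + 1)).J) (hj : ⟨n + 1, j⟩ ∉ P.V) :
      (D (n + 1)).inj j ≫ P.h n = 0 := by
    rw [← P.supp, (D (n + 1)).inj_p_of_notMem_assoc (by exact hj)]
  refine ⟨⟨P.V ∪ W, fun n => P.h n + r (n + 1) ≫ k n, fun x hx => ?_,
    fun n => (D (n + 1)).hom_ext fun j => ?_, fun n j hj => ?_⟩,
    ⟨Set.subset_union_left, fun n => ?_⟩, Or.inr (hxW rfl)⟩
  · rcases hx with hx | hx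
    · exact (P.closed x hx).trans Set.subset_union_left
    · exact (hW x hx).trans Set.subset_union_right
  · by_cases hj : ⟨n + 1, j⟩ ∈ P.V ∪ W
    · rw [(D (n + 1)).inj_p_of_mem_assoc (by exact hj)]
    · rw [(D (n + 1)).inj_p_of_notMem_assoc (by exact hj), Preadditive.comp_add,
        hres n j fun h => hj (Or.inl h), ← Category.assoc, hr' fun h => hj (Or.inr h)]
      simp
  · by_cases hj' : ⟨n + 1, j⟩ ∈ P.V
    · have h1 : (D (n + 1)).inj j ≫ Z.d (n + 1) (n + 1 + 1) ≫ r (n + 1 + 1) = 0 := by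
        rw [← hqr, reassoc_of% hqdq hj']
        simp
      have h2 := hr hj'
      have h3 := P.contr n j hj'
      simp only [Preadditive.comp_add, Preadditive.add_comp, Category.assoc, reassoc_of% h1,
        reassoc_of% h2] at h3 ⊢
      simpa using h3
    · have hjW : ⟨n + 1, j⟩ ∈ W := hj.resolve_left hj'
      have h1 : (D (n + 1)).inj j ≫ r (n + 1) ≫ s (n + 1) = (D (n + 1)).inj j := by
        rw [hrs, hq_mem hjW hj']
      have h2 : (D (n + 1)).inj j ≫ r (n + 1) ≫ f.f (n + 1) = (D (n + 1)).inj j ≫ u.f (n + 1) := by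
        change _ ≫ _ ≫ s (n + 1) ≫ u.f (n + 1) = _
        rw [reassoc_of% h1]
      rw [hk n, hd] at h2
      have h3 : u.f (n + 1) = 𝟙 _ - (Z.d (n + 1) (n + 1 + 1) ≫ P.h (n + 1) +
          P.h n ≫ Z.d n (n + 1)) := by
        rw [← hφ]
        simp [u]
      rw [h3] at h2
      simp only [Preadditive.comp_add, Preadditive.add_comp, Preadditive.comp_sub, Category.assoc,
        reassoc_of% h1, Category.comp_id] at h2 ⊢
      rw [add_add_add_comm, h2]
      abel
  · have h1 : (D (n + 1)).p (degreePart D P.V (n + 1)) ≫ r (n + 1) = 0 :=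
      (D (n + 1)).p_comp_eq_zero fun j hj => hr hj
    rw [Preadditive.comp_add, P.supp, reassoc_of% h1]
    simp

lemma isZero_toK_obj_of_countable (hZ : ∀ Q : CochainComplex B ℤ, (∀ n, Q.X n ∈ Set.range E) →
    ∀ f : Q ⟶ Z, (toK B).map f = 0) (D : ∀ n, FpDecomposition E (Z.X n)) :
    IsZero ((toK B).obj Z) := by
  obtain ⟨T, hTc, hT⟩ := exists_support_d Z D
  obtain ⟨P, hP⟩ := exists_maximal_of_chains_bounded
    (PartialContraction.exists_chain_bound hT) fun {P Q R} h₁ h₂ => ⟨h₁.1.trans h₂.1, fun n => by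
      rw [← h₁.2, ← h₂.2, ← Category.assoc, (D (n + 1)).p_comp_of_subset]
      exact fun j hj => h₁.1 hj⟩
  have hV (x) : x ∈ P.V := by
    obtain ⟨Q, hQ, hx⟩ := P.exists_extension hTc hT hZ x
    exact (hP Q hQ).1 hx
  refine (isZero_toK_obj_iff Z).2 ⟨P.h, fun n => (D (n + 1)).hom_ext fun j => ?_⟩
  rw [P.contr n j (hV _), Category.comp_id]

lemma exists_countable_subcomplex (D : ∀ n, FpDecomposition E (Z.X n))
    {U₀ : Set (Σ n, (D n).J)} (hU₀ : U₀.Countable) :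
    ∃ (U : Set (Σ n, (D n).J)) (_ : U₀ ⊆ U) (Q : CochainComplex B ℤ)
      (_ : ∀ n, Q.X n ∈ Set.range E) (s : Q ⟶ Z) (r : ∀ n, Z.X n ⟶ Q.X n),
      (∀ n, s.f n ≫ r n = 𝟙 _) ∧ ∀ n, r n ≫ s.f n = (D n).p (degreePart D U n) := by
  obtain ⟨T, hTc, hT⟩ := exists_support_d Z D
  obtain ⟨U, hU₀, hUc, hU⟩ := exists_countable_closed T hTc hU₀
  let q (n : ℤ) : Z.X n ⟶ Z.X n := (D n).p (degreePart D U n)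
  have hq (n : ℤ) : q n ≫ Z.d n (n + 1) ≫ q (n + 1) = q n ≫ Z.d n (n + 1) :=
    (D n).hom_ext fun j => by
      by_cases hj : ⟨n, j⟩ ∈ U
      · rw [(D n).inj_p_of_mem_assoc (by exact hj), (D n).inj_p_of_mem_assoc (by exact hj)]
        exact hT U hU n j hj
      · rw [(D n).inj_p_of_notMem_assoc (by exact hj), (D n).inj_p_of_notMem_assoc (by exact hj)]
  obtain ⟨Q, hQ, s, r, hsr, hrs, hd⟩ := exists_complex_of_split Z q
    (fun n => (D n).exists_split (hUc.preimage sigma_mk_injective)) fun i j k => by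
      by_cases hij : i + 1 = j
      · by_cases hjk : j + 1 = k
        · subst hij hjk
          rw [reassoc_of% hq i]
          simp
        · simp [Z.shape j k hjk]
      · simp [Z.shape i j hij]
  have hsq (n : ℤ) : s n ≫ q n = s n := by rw [← hrs, ← Category.assoc, hsr, Category.id_comp]
  refine ⟨U, hU₀, Q, hQ, ⟨s, fun i j hij => ?_⟩, r, hsr, hrs⟩
  obtain rfl : i + 1 = j := hij
  rw [hd, Category.assoc, Category.assoc, hrs, ← hsq, Category.assoc, Category.assoc, hq]

variable [HasZeroObject B] [HasBinaryBiproducts B]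

/-- Morphisms into a coproduct are determined by their components. -/
lemma IsPureSemisimple.hom_ext_cofanPi (hB : IsFinitelyAccessible B) (hS : IsPureSemisimple.{v} B)
    {I : Type v} {X : I → B} {c : Cofan X} (hc : IsColimit c) {Y : B} {f g : Y ⟶ c.pt}
    (h : ∀ i, f ≫ cofanPi hc i = g ≫ cofanPi hc i) : f = g := by
  obtain ⟨ι, G, hG₁, hG₂⟩ := hB.exists_fpSet
  obtain ⟨J, a, c', ⟨hc'⟩, rfl⟩ := hS.exists_isColimit hB ⟨hG₁, hG₂⟩ Y
  refine cofan_hom_ext hc' fun j => ?_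
  rw [← sub_eq_zero, ← Preadditive.comp_sub]
  obtain ⟨F, hF, hfF⟩ := (hG₁ (a j)).exists_finite_support hB hc (c'.inj j ≫ (f - g))
  rw [← hfF, ← hF.coe_toFinset, cofanProj_coe_finset, Preadditive.comp_sum]
  refine Finset.sum_eq_zero fun i _ => ?_
  have : (f - g) ≫ cofanPi hc i = 0 := by rw [Preadditive.sub_comp, h, sub_self]
  rw [Category.assoc, reassoc_of% this, zero_comp, comp_zero]

open Cardinal in
lemma IsPureSemisimple.isWellGeneratedOfCard_aleph_one (hB : IsFinitelyAccessible B)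
    (hS : IsPureSemisimple.{v} B) :
    IsWellGeneratedOfCard (HomotopyCategory B (ComplexShape.up ℤ)) Set.univ (aleph 1) := by
  have := hB.hasCoproducts
  obtain ⟨ι, G, hG₁, hG₂⟩ := hB.exists_fpSet
  have hG : IsFpFamily G := ⟨hG₁, fun a ha => hG₂ a ha⟩
  have hD (Z : CochainComplex B ℤ) (n : ℤ) :
      Nonempty (FpDecomposition (countableCoproduct G) (Z.X n)) :=
    hS.nonempty_fpDecomposition hB hG _
  refine ⟨isRegular_aleph_one, complexesOver (countableCoproduct G), Set.subset_univ _,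
    small_complexesOver _, ?_, ?_, ?_⟩
  · intro Z _ hZ
    obtain ⟨Z, rfl⟩ := HomotopyCategory.quotient_obj_surjective Z
    exact isZero_toK_obj_of_countable (fun Q hQ f => hZ _ ⟨Q, hQ, rfl⟩ _) fun n => (hD Z n).some
  · rintro _ ⟨P, hP, rfl⟩
    refine isKappaSmall_toK P fun {I X c} hc f => ?_
    choose U hU hfU using fun n => exists_countable_support hG₁
      (cofanProj (isColimitEvalCofan hc n)) (cofanProj_comp_of_subset _)
      (fun hb f => hb.exists_finite_support hB (isColimitEvalCofan hc n) f) (hP n) (f.f n)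
    refine ⟨⋃ n, U n, ?_, ?_⟩
    · have h1 : (⋃ n, U n).Countable := Set.countable_iUnion hU
      rw [← succ_aleph0, Order.lt_succ_iff, le_aleph0_iff_set_countable]
      exact h1
    · congr 1
      ext n
      rw [HomologicalComplex.comp_f, eval_cofanProj]
      exact (supported_mono (isColimitEvalCofan hc n) (Set.subset_iUnion U n) (hfU n)).symm
  · rintro _ ⟨P, hP, rfl⟩
    apply factorsThroughFamily_toK
    intro I X c hc f
    let D (i : I) (n : ℤ) := (hD (X i) n).some
    choose U₀ hU₀ hfU₀ using fun i n => exists_countable_support hG₁ (D i n).p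
      (D i n).p_comp_of_subset (D i n).exists_support (hP n)
      (f.f n ≫ cofanPi (isColimitEvalCofan hc n) i)
    choose U hU Q hQ s r hsr hrs using fun i => exists_countable_subcomplex (D i)
      (U₀ := ⋃ n, Sigma.mk n '' U₀ i n) (Set.countable_iUnion fun n => (hU₀ i n).image _)
    obtain ⟨cz, ⟨hcz⟩⟩ := exists_cofan_complex Q
    let σ : cz.pt ⟶ c.pt := cofanDesc hcz fun i => s i ≫ c.inj i
    let R (n : ℤ) : c.pt.X n ⟶ cz.pt.X n :=
      cofanDesc (isColimitEvalCofan hc n) fun i => r i n ≫ (cz.inj i).f n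
    have hσ (i : I) (n : ℤ) : (cz.inj i).f n ≫ σ.f n = (s i).f n ≫ (c.inj i).f n := by
      rw [← HomologicalComplex.comp_f, inj_cofanDesc]
      rfl
    have hR (i : I) (n : ℤ) : (c.inj i).f n ≫ R n = r i n ≫ (cz.inj i).f n :=
      inj_cofanDesc (isColimitEvalCofan hc n) _ i
    have hσR (n : ℤ) : σ.f n ≫ R n = 𝟙 _ := cofan_hom_ext (isColimitEvalCofan hcz n) fun i => by
      change (cz.inj i).f n ≫ σ.f n ≫ R n = (cz.inj i).f n ≫ 𝟙 _
      rw [← Category.assoc, hσ, Category.assoc, hR, ← Category.assoc, hsr]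
      simp
    let π (i : I) (n : ℤ) : c.pt.X n ⟶ (X i).X n := cofanPi (isColimitEvalCofan hc n) i
    have hπ (i : I) (n : ℤ) : (c.inj i).f n ≫ π i n = 𝟙 _ :=
      inj_cofanPi (isColimitEvalCofan hc n) i
    have hπ' {i j : I} (h : j ≠ i) (n : ℤ) : (c.inj j).f n ≫ π i n = 0 :=
      inj_cofanPi_of_ne (isColimitEvalCofan hc n) h
    have hRσπ (i : I) (n : ℤ) : R n ≫ σ.f n ≫ π i n =
        π i n ≫ (D i n).p (degreePart (D i) (U i) n) := by
      refine cofan_hom_ext (isColimitEvalCofan hc n) fun j => ?_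
      change (c.inj j).f n ≫ R n ≫ σ.f n ≫ π i n = (c.inj j).f n ≫ π i n ≫ _
      rw [reassoc_of% hR j n, reassoc_of% hσ j n]
      by_cases hj : j = i
      · subst hj
        rw [hπ, Category.comp_id, hrs, reassoc_of% hπ]
      · rw [hπ' hj, comp_zero, comp_zero, reassoc_of% hπ' hj, zero_comp]
    have hfRσ (n : ℤ) : f.f n ≫ R n ≫ σ.f n = f.f n := by
      refine hS.hom_ext_cofanPi hB (isColimitEvalCofan hc n) fun i => ?_
      change (f.f n ≫ R n ≫ σ.f n) ≫ π i n = f.f n ≫ π i n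
      rw [Category.assoc, Category.assoc, hRσπ, ← Category.assoc]
      refine (D i n).supported_mono (fun x hx => hU i ?_) (hfU₀ i n)
      exact Set.mem_iUnion.2 ⟨n, x, hx, rfl⟩
    have hfR (i j : ℤ) : (f.f i ≫ R i) ≫ cz.pt.d i j = P.d i j ≫ f.f j ≫ R j := by
      have h1 : cz.pt.d i j = σ.f i ≫ c.pt.d i j ≫ R j := by
        rw [← Category.assoc, σ.comm, Category.assoc, hσR, Category.comp_id]
      rw [h1, ← f.comm_assoc]
      simp only [Category.assoc]
      rw [reassoc_of% hfRσ i]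
    refine ⟨Q, fun i => ⟨Q i, hQ i, rfl⟩, s, cz, hcz,
      ⟨fun n => f.f n ≫ R n, fun i j _ => hfR i j⟩, ?_⟩
    congr 1
    ext n
    exact (hfRσ n).symm.trans (Category.assoc _ _ _).symm

end

/-- The coproduct of copies of an object indexed by the natural numbers has no nonzero
morphisms into it that are invariant under the translation. -/
lemma eq_zero_of_translation {T : Type u} [Category.{v} T] [Preadditive T]
    [HasCoproducts.{v} T] (Z : T) (sh : (∐ fun _ : ULift.{v} ℕ => Z) ⟶ ∐ fun _ : ULift.{v} ℕ => Z)
    (hsh : ∀ n : ℕ, Limits.Sigma.ι (fun _ : ULift.{v} ℕ => Z) ⟨n⟩ ≫ sh =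
      Limits.Sigma.ι (fun _ : ULift.{v} ℕ => Z) ⟨n + 1⟩)
    {Y : T} (y : Y ⟶ ∐ fun _ : ULift.{v} ℕ => Z) (hy : y ≫ sh = y) : y = 0 := by
  let r : (∐ fun _ : ULift.{v} ℕ => Z) ⟶ ∐ fun _ : ULift.{v} ℕ => Z :=
    Limits.Sigma.desc fun n => -∑ m ∈ Finset.range n.down,
      Limits.Sigma.ι (fun _ : ULift.{v} ℕ => Z) ⟨m⟩
  have h : (𝟙 _ - sh) ≫ r = 𝟙 _ := Limits.Sigma.hom_ext _ _ fun ⟨n⟩ => by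
    rw [Preadditive.sub_comp, Preadditive.comp_sub, ← Category.assoc _ sh, hsh]
    simp [r, Finset.sum_range_succ]
  calc y = y ≫ (𝟙 _ - sh) ≫ r := by rw [h, Category.comp_id]
    _ = 0 := by rw [← Category.assoc, Preadditive.comp_sub, hy]; simp

section

open Pretriangulated

variable {T : Type u} [Category.{v} T] [HasShift T ℤ] [Preadditive T]
  [HasCoproducts.{v} T]

/-- A family of objects satisfying the conditions on a set of generators in the definition of
well generated categories other than the smallness of its members. -/
structure IsGeneratingFamily {σ : Type v} (S : σ → T) : Prop where
  isZero : ∀ X : T, (∀ i (f : S i ⟶ X), f = 0) → IsZero X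
  exists_shift : ∀ i, ∃ j, Nonempty (S i ≅ (S j)⟦(1 : ℤ)⟧)
  exists_fac : ∀ i {J : Type v} (X : J → T) (f : S i ⟶ ∐ X), ∃ (k : J → σ)
    (φ : ∀ j, S (k j) ⟶ X j) (g : S i ⟶ ∐ fun j => S (k j)), f = g ≫ Limits.Sigma.map φ

namespace IsGeneratingFamily

variable {σ : Type v} {S : σ → T}

lemma comp_shift_eq_zero [∀ n : ℤ, (shiftFunctor T n).Additive]
    (hS : IsGeneratingFamily S) {X Y : T} (g : X ⟶ Y) (hg : ∀ i (f : S i ⟶ X), f ≫ g = 0 → f = 0)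
    {i : σ} (f : S i ⟶ X⟦(1 : ℤ)⟧) (hf : f ≫ g⟦(1 : ℤ)⟧' = 0) : f = 0 := by
  obtain ⟨j, ⟨e⟩⟩ := hS.exists_shift i
  obtain ⟨w, hw⟩ := (shiftFunctor T (1 : ℤ)).map_surjective (e.inv ≫ f)
  have h1 : w ≫ g = 0 := (shiftFunctor T (1 : ℤ)).map_injective (by
    rw [Functor.map_comp, hw, Category.assoc, hf, comp_zero, Functor.map_zero])
  rw [hg j w h1, Functor.map_zero] at hw
  rw [← cancel_epi e.inv, ← hw, comp_zero]

variable [HasZeroObject T] [∀ n : ℤ, (shiftFunctor T n).Additive] [Pretriangulated T]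

lemma comp_eq_zero (hS : IsGeneratingFamily S) {J : Type v} {X Z : J → T}
    (p : ∀ j, X j ⟶ Z j) {Y : T} (g : ∐ X ⟶ Y)
    (hg : ∀ j i (f : S i ⟶ X j), f ≫ p j = 0 → f ≫ Limits.Sigma.ι X j ≫ g = 0)
    {i : σ} (f : S i ⟶ ∐ X) (hf : f ≫ Limits.Sigma.map p = 0) : f ≫ g = 0 := by
  choose K κ δ hκ using fun j => distinguished_cocone_triangle₁ (p j)
  obtain ⟨C, q, ε, hq⟩ := distinguished_cocone_triangle (Limits.Sigma.map κ)
  have hκq : Limits.Sigma.map κ ≫ q = 0 := comp_distTriang_mor_zero₁₂ _ hq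
  have hκp (j) : κ j ≫ p j = 0 := comp_distTriang_mor_zero₁₂ _ (hκ j)
  have exists_ρ (j) : ∃ ρ : Z j ⟶ C, Limits.Sigma.ι X j ≫ q = p j ≫ ρ :=
    Triangle.yoneda_exact₂ _ (hκ j) (Limits.Sigma.ι X j ≫ q) (by
      change κ j ≫ Limits.Sigma.ι X j ≫ q = 0
      rw [← Limits.Sigma.ι_map_assoc, hκq, comp_zero])
  choose ρ hρ using exists_ρ
  have hq' : q = Limits.Sigma.map p ≫ Limits.Sigma.desc ρ := Limits.Sigma.hom_ext _ _ fun j => by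
    rw [hρ]
    simp
  obtain ⟨w, hw⟩ := Triangle.coyoneda_exact₂ _ hq f (by
    change f ≫ q = 0
    rw [hq', ← Category.assoc, hf, zero_comp])
  obtain ⟨k, φ, w, rfl⟩ := hS.exists_fac i _ w
  have : Limits.Sigma.map φ ≫ Limits.Sigma.map κ ≫ g = 0 := Limits.Sigma.hom_ext _ _ fun j => by
    rw [Limits.Sigma.ι_map_assoc, Limits.Sigma.ι_map_assoc, comp_zero, ← Category.assoc]
    exact hg j _ _ (by rw [Category.assoc, hκp, comp_zero])
  rw [hw]
  change ((w ≫ Limits.Sigma.map φ) ≫ Limits.Sigma.map κ) ≫ g = 0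
  rw [Category.assoc, Category.assoc, this, comp_zero]

lemma exists_step {L : Set T} (hL : IsLocalizing T L) (hSL : ∀ i, S i ∈ L) {X Z : T} (p : X ⟶ Z)
    (hX : X ∈ L) : ∃ (X' : T) (p' : X' ⟶ Z) (t : X ⟶ X'), X' ∈ L ∧ t ≫ p' = p ∧
      ∀ i (f : S i ⟶ X), f ≫ p = 0 → f ≫ t = 0 := by
  let I := Σ i, {f : S i ⟶ X // f ≫ p = 0}
  let d : (∐ fun x : I => S x.1) ⟶ X := Limits.Sigma.desc fun x => x.2.1
  obtain ⟨X', t, δ, h⟩ := distinguished_cocone_triangle d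
  have hd : d ≫ p = 0 := Limits.Sigma.hom_ext _ _ fun x => by simp [d, x.2.2]
  have hdt : d ≫ t = 0 := comp_distTriang_mor_zero₁₂ _ h
  obtain ⟨p', hp'⟩ := Triangle.yoneda_exact₂ _ h p hd
  refine ⟨X', p', t, ?_, hp'.symm, fun i f hf => ?_⟩
  · refine hL.ext₂ _ (rot_of_distTriang _ h) hX ?_
    exact hL.shiftClosed _ 1 (hL.coproductClosed _ (fun x : I => hSL x.1) _
      (coproductIsCoproduct fun x : I => S x.1))
  · have : f = Limits.Sigma.ι (fun x : I => S x.1) ⟨i, f, hf⟩ ≫ d := by simp [d]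
    rw [this, Category.assoc, hdt, comp_zero]

lemma mem_of_isLocalizing (hS : IsGeneratingFamily S) {L : Set T} (hL : IsLocalizing T L)
    (hSL : ∀ i, S i ∈ L) (Z : T) : Z ∈ L := by
  choose N P t hN hP ht using fun s : Σ' (X : T) (_ : X ⟶ Z), X ∈ L =>
    exists_step hL hSL s.2.1 s.2.2
  let I₀ := Σ i, S i ⟶ Z
  let s : ℕ → Σ' (X : T) (_ : X ⟶ Z), X ∈ L := fun n => Nat.rec
    ⟨∐ fun x : I₀ => S x.1, Limits.Sigma.desc fun x => x.2,
      hL.coproductClosed _ (fun x : I₀ => hSL x.1) _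
        (coproductIsCoproduct fun x : I₀ => S x.1)⟩
    (fun _ s => ⟨N s, P s, hN s⟩) n
  let X (n : ℕ) : T := (s n).1
  let p (n : ℕ) : X n ⟶ Z := (s n).2.1
  let τ (n : ℕ) : X n ⟶ X (n + 1) := t (s n)
  have hτp (n : ℕ) : τ n ≫ p (n + 1) = p n := hP (s n)
  have hτ (n : ℕ) (i : σ) (f : S i ⟶ X n) (hf : f ≫ p n = 0) : f ≫ τ n = 0 := ht (s n) i f hf
  have h₀ (i : σ) (f : S i ⟶ Z) : ∃ g : S i ⟶ X 0, g ≫ p 0 = f :=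
    ⟨Limits.Sigma.ι (fun x : I₀ => S x.1) ⟨i, f⟩, by simp [p, s]⟩
  have hXL (n : ℕ) : X n ∈ L := (s n).2.2
  clear_value τ p X
  let J := ULift.{v} ℕ
  let F (j : J) : T := X j.down
  let t' : ∐ F ⟶ ∐ F := Limits.Sigma.desc fun j => τ j.down ≫ Limits.Sigma.ι F ⟨j.down + 1⟩
  have ht' (n : ℕ) : Limits.Sigma.ι F ⟨n⟩ ≫ t' = τ n ≫ Limits.Sigma.ι F ⟨n + 1⟩ := by simp [t']
  obtain ⟨W, a, δ, hW⟩ := distinguished_cocone_triangle (𝟙 _ - t')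
  have hCL : ∐ F ∈ L := hL.coproductClosed F (fun j => hXL j.down) _ (coproductIsCoproduct F)
  have hWL : W ∈ L := hL.ext₂ _ (rot_of_distTriang _ hW) hCL (hL.shiftClosed _ 1 hCL)
  have hφa : t' ≫ a = a := by
    have : (𝟙 _ - t') ≫ a = 0 := comp_distTriang_mor_zero₁₂ _ hW
    rw [Preadditive.sub_comp, Category.id_comp, sub_eq_zero] at this
    exact this.symm
  let q : ∐ F ⟶ Z := Limits.Sigma.desc fun j => p j.down
  have hq (n : ℕ) : Limits.Sigma.ι F ⟨n⟩ ≫ q = p n := by simp [q]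
  have hφq : (𝟙 _ - t') ≫ q = 0 := Limits.Sigma.hom_ext _ _ fun ⟨n⟩ => by
    rw [Preadditive.sub_comp, Preadditive.comp_sub, ← Category.assoc _ t', ht', Category.assoc, hq,
      hτp, Category.id_comp, hq, sub_self, comp_zero]
  obtain ⟨π, hπ⟩ := Triangle.yoneda_exact₂ _ hW q hφq
  change W ⟶ Z at π
  change q = a ≫ π at hπ
  have hτa (n : ℕ) : τ n ≫ Limits.Sigma.ι F ⟨n + 1⟩ ≫ a = Limits.Sigma.ι F ⟨n⟩ ≫ a := by
    rw [← Category.assoc, ← ht', Category.assoc, hφa]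
  have injective_t' (i : σ) (f : S i ⟶ ∐ F) (hf : f ≫ (𝟙 _ - t') = 0) : f = 0 := by
    rw [Preadditive.comp_sub, Category.comp_id, sub_eq_zero] at hf
    let r : (∐ F) ⟶ ∐ fun _ : J => Z := Limits.Sigma.map fun j => p j.down
    let sh : (∐ fun _ : J => Z) ⟶ ∐ fun _ : J => Z :=
      Limits.Sigma.desc fun j => Limits.Sigma.ι (fun _ : J => Z) ⟨j.down + 1⟩
    have hr : t' ≫ r = r ≫ sh := Limits.Sigma.hom_ext _ _ fun ⟨n⟩ => by
      rw [← Category.assoc, ht']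
      simp [r, sh, reassoc_of% hτp]
    have h0 : f ≫ r = 0 := eq_zero_of_translation Z sh (fun n => Limits.Sigma.ι_desc _ _) _ (by
      rw [Category.assoc, ← hr, ← Category.assoc, ← hf])
    rw [hf]
    refine hS.comp_eq_zero (fun j : J => p j.down) t' (fun ⟨n⟩ i f hf => ?_) f h0
    rw [ht', ← Category.assoc, hτ n i f hf, zero_comp]
  have exists_T (n : ℕ) : ∃ θ : X 0 ⟶ X n, θ ≫ p n = p 0 ∧
      θ ≫ Limits.Sigma.ι F ⟨n⟩ ≫ a = Limits.Sigma.ι F ⟨0⟩ ≫ a := by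
    induction n with
    | zero => exact ⟨𝟙 _, by simp, by simp⟩
    | succ n ih =>
      obtain ⟨θ, h₁, h₂⟩ := ih
      exact ⟨θ ≫ τ n, by rw [Category.assoc, hτp, h₁], by rw [Category.assoc, hτa, h₂]⟩
  choose θ hθp hθa using exists_T
  have hkill (n : ℕ) (i : σ) (f : S i ⟶ X n) (hf : f ≫ p n = 0) :
      f ≫ Limits.Sigma.ι F ⟨n⟩ ≫ a = 0 := by
    rw [← hτa, ← Category.assoc, hτ n i f hf, zero_comp]
  have zero_of_comp_q (i : σ) (f : S i ⟶ ∐ F) (hf : f ≫ q = 0) : f ≫ a = 0 := by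
    obtain ⟨k, φ, w, rfl⟩ := hS.exists_fac i F f
    choose χ hχ using fun j : J => h₀ (k j) (φ j ≫ p j.down)
    have h1 (j : J) : φ j ≫ Limits.Sigma.ι F j ≫ a = χ j ≫ Limits.Sigma.ι F ⟨0⟩ ≫ a := by
      have := hkill j.down _ (φ j - χ j ≫ θ j.down) (by
        rw [Preadditive.sub_comp, Category.assoc, hθp, hχ, sub_self])
      rw [Preadditive.sub_comp, sub_eq_zero, Category.assoc, hθa] at this
      exact this
    have h2 : Limits.Sigma.map φ ≫ a = Limits.Sigma.desc χ ≫ Limits.Sigma.ι F ⟨0⟩ ≫ a :=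
      Limits.Sigma.hom_ext _ _ fun j => by
        rw [Limits.Sigma.ι_map_assoc, h1, Limits.Sigma.ι_desc_assoc]
    have h3 : Limits.Sigma.map φ ≫ q = Limits.Sigma.desc χ ≫ p 0 :=
      Limits.Sigma.hom_ext _ _ fun j => by
        rw [Limits.Sigma.ι_map_assoc, Limits.Sigma.ι_desc_assoc, hχ]
        exact congrArg _ (hq j.down)
    rw [Category.assoc, h2, ← Category.assoc]
    refine hkill 0 i _ ?_
    rw [Category.assoc, ← h3, ← Category.assoc, hf]
  have injective_π (i : σ) (f : S i ⟶ W) (hf : f ≫ π = 0) : f = 0 := by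
    have h1 : f ≫ δ = 0 := hS.comp_shift_eq_zero (𝟙 _ - t') injective_t' (f ≫ δ) (by
      have : δ ≫ (𝟙 _ - t')⟦(1 : ℤ)⟧' = 0 := comp_distTriang_mor_zero₃₁ _ hW
      rw [Category.assoc, this, comp_zero])
    obtain ⟨g, hg⟩ := Triangle.coyoneda_exact₃ _ hW f h1
    change S i ⟶ ∐ F at g
    change f = g ≫ a at hg
    rw [hg]
    exact zero_of_comp_q i g (by rw [hπ, ← Category.assoc, ← hg, hf])
  obtain ⟨K, κ, ε, hK⟩ := distinguished_cocone_triangle π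
  have hK0 : IsZero K := hS.isZero _ fun i f => by
    have h1 : f ≫ ε = 0 := hS.comp_shift_eq_zero π injective_π (f ≫ ε) (by
      have : ε ≫ π⟦(1 : ℤ)⟧' = 0 := comp_distTriang_mor_zero₃₁ _ hK
      rw [Category.assoc, this, comp_zero])
    obtain ⟨g, hg⟩ := Triangle.coyoneda_exact₃ _ hK f h1
    change S i ⟶ Z at g
    change f = g ≫ κ at hg
    obtain ⟨g, rfl⟩ := h₀ i g
    have h2 : π ≫ κ = 0 := comp_distTriang_mor_zero₁₂ _ hK
    rw [hg, ← hq, hπ, Category.assoc, Category.assoc, Category.assoc, h2, comp_zero, comp_zero,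
      comp_zero]
  have : IsIso π := (Triangle.isZero₃_iff_isIso₁ _ hK).1 hK0
  exact hL.isoClosed (asIso π) hWL

end IsGeneratingFamily

end

section

variable {T : Type u} [Category.{v} T] [HasShift T ℤ] [Preadditive T] [HasCoproducts.{v} T]

lemma GeneratesWell.exists_isGeneratingFamily {κ : Cardinal.{v}} {S : Set T}
    (hS : GeneratesWell T Set.univ κ S) :
    ∃ (σ : Type v) (s : σ → T), (∀ i, s i ∈ S) ∧
      IsGeneratingFamily fun x : σ × ℤ => (s x.1)⟦x.2⟧ := by
  have := hS.isSmall
  refine ⟨Shrink.{v} S, fun i => ((equivShrink S).symm i).1, fun i => Subtype.coe_prop _,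
    ⟨fun X hX => hS.nondegenerate X (Set.mem_univ _) fun Y hY f => ?_, fun x => ?_, ?_⟩⟩
  · obtain ⟨i, hi⟩ := (equivShrink S).symm.surjective ⟨Y, hY⟩
    obtain rfl : ((equivShrink S).symm i).1 = Y := congrArg Subtype.val hi
    have e := (shiftFunctorZero T ℤ).app ((equivShrink S).symm i).1
    rw [← cancel_epi e.hom, comp_zero]
    exact hX ⟨i, 0⟩ _
  · exact ⟨⟨x.1, x.2 - 1⟩, ⟨(shiftFunctorAdd' T (x.2 - 1) 1 x.2 (by simp)).app _⟩⟩
  · rintro ⟨i, n⟩ J X f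
    let F := shiftFunctor T n
    let G := shiftFunctor T (-n)
    let adj : F ⊣ G := (shiftEquiv T n).toAdjunction
    let hG : IsColimit (Cofan.mk (G.obj (∐ X)) fun j => G.map (Limits.Sigma.ι X j)) :=
      isColimitCofanMkObjOfIsColimit G X _ (coproductIsCoproduct X)
    obtain ⟨Z, hZ, φ, cz, hcz, g, hg⟩ := hS.factors _ (Subtype.coe_prop _)
      (fun j => G.obj (X j)) (fun _ => Set.mem_univ _) _ hG (adj.homEquiv _ _ f)
    obtain ⟨k, rfl⟩ : ∃ k : J → Shrink S, Z = fun j => ((equivShrink S).symm (k j)).1 :=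
      ⟨fun j => equivShrink S ⟨Z j, hZ j⟩, by simp⟩
    let hF : IsColimit (Cofan.mk (F.obj cz.pt) fun j => F.map (cz.inj j)) :=
      isColimitCofanMkObjOfIsColimit F _ _ (hcz.ofIsoColimit (Cofan.ext (Iso.refl _)))
    let ψ (j : J) := (adj.homEquiv _ _).symm (φ j)
    refine ⟨fun j => ⟨k j, n⟩, ψ, F.map g ≫ cofanDesc hF (Limits.Sigma.ι _), ?_⟩
    have h1 (j : J) : F.map (cz.inj j) ≫ F.map (hcz.desc (Cofan.mk (G.obj (∐ X)) fun j =>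
        φ j ≫ G.map (Limits.Sigma.ι X j))) ≫ adj.counit.app (∐ X) =
          ψ j ≫ Limits.Sigma.ι X j := by
      have h2 : cz.inj j ≫ hcz.desc (Cofan.mk (G.obj (∐ X)) fun j =>
          φ j ≫ G.map (Limits.Sigma.ι X j)) = φ j ≫ G.map (Limits.Sigma.ι X j) :=
        hcz.fac (Cofan.mk _ _) ⟨j⟩
      rw [← Functor.map_comp_assoc, h2]
      simp [ψ, Adjunction.homEquiv_counit]
    have h3 : F.map (hcz.desc (Cofan.mk (G.obj (∐ X)) fun j => φ j ≫ G.map (Limits.Sigma.ι X j))) ≫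
        adj.counit.app (∐ X) = cofanDesc hF (Limits.Sigma.ι _) ≫ Limits.Sigma.map ψ :=
      cofan_hom_ext hF fun j => (h1 j).trans
        ((Limits.Sigma.ι_map ψ j).symm.trans (inj_cofanDesc_assoc hF _ j _).symm)
    rw [← (adj.homEquiv _ _).symm_apply_apply f, hg, Adjunction.homEquiv_counit, Functor.map_comp,
      Category.assoc, Category.assoc]
    exact congrArg _ h3

variable [HasZeroObject T] [∀ n : ℤ, (shiftFunctor T n).Additive] [Pretriangulated T]

lemma GeneratesWell.mem_of_isLocalizing {κ : Cardinal.{v}} {S L : Set T}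
    (hS : GeneratesWell T Set.univ κ S) (hL : IsLocalizing T L) (hSL : S ⊆ L) (Z : T) :
    Z ∈ L := by
  obtain ⟨σ, s, hs, h⟩ := hS.exists_isGeneratingFamily
  exact h.mem_of_isLocalizing hL (fun x => hL.shiftClosed _ _ (hSL (hs x.1))) Z

end

section AddClosure

variable {B : Type u} [Category.{v} B]

/-- `Y` is a direct summand of a coproduct of copies of `X`. -/
def IsInAdd (X Y : B) : Prop :=
  ∃ (I : Type v) (c : Cofan fun _ : I => X) (_ : IsColimit c), IsRetractOf Y c.pt

lemma IsRetractOf.trans {X Y Z : B} (h : IsRetractOf X Y) (h' : IsRetractOf Y Z) :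
    IsRetractOf X Z := by
  obtain ⟨s, r, h⟩ := h
  obtain ⟨s', r', h'⟩ := h'
  exact ⟨s ≫ s', r' ≫ r, by rw [Category.assoc, reassoc_of% h', h]⟩

lemma IsInAdd.of_isRetractOf {X Y Y' : B} (h : IsInAdd X Y) (h' : IsRetractOf Y' Y) :
    IsInAdd X Y' := by
  obtain ⟨I, c, hc, h⟩ := h
  exact ⟨I, c, hc, h'.trans h⟩

lemma IsInAdd.coproduct [HasCoproducts.{v} B] {X : B} {J : Type v} {Y : J → B}
    (h : ∀ j, IsInAdd X (Y j)) {c : Cofan Y} (hc : IsColimit c) : IsInAdd X c.pt := by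
  choose I d hd s r hsr using h
  let F : (Σ j, I j) → B := fun _ => X
  refine ⟨Σ j, I j, _, coproductIsCoproduct F,
    cofanDesc hc fun j => s j ≫ cofanDesc (hd j) fun i => Limits.Sigma.ι F ⟨j, i⟩,
    Limits.Sigma.desc fun x => (d x.1).inj x.2 ≫ r x.1 ≫ c.inj x.1, ?_⟩
  refine cofan_hom_ext hc fun j => ?_
  have : (cofanDesc (hd j) fun i => Limits.Sigma.ι F ⟨j, i⟩) ≫
      (Limits.Sigma.desc fun x : Σ j, I j => (d x.1).inj x.2 ≫ r x.1 ≫ c.inj x.1) =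
        r j ≫ c.inj j :=
    cofan_hom_ext (hd j) fun i => by simp
  rw [inj_cofanDesc_assoc, Category.comp_id]
  refine (Category.assoc _ _ _).trans ?_
  refine (congrArg _ this).trans ?_
  rw [reassoc_of% hsr]

lemma IsInAdd.self (X : B) [HasCoproducts.{v} B] : IsInAdd X X :=
  ⟨PUnit, _, coproductIsCoproduct fun _ : PUnit => X, Limits.Sigma.ι (fun _ : PUnit => X) ⟨⟩,
    Limits.Sigma.desc fun _ => 𝟙 X, Limits.Sigma.ι_desc _ _⟩

variable [Preadditive B]

lemma IsInAdd.biprod {X Y Y' Z : B} (h : IsInAdd X Y) (h' : IsInAdd X Y')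
    [HasCoproducts.{v} B] (i : Y ⟶ Z) (i' : Y' ⟶ Z) (p : Z ⟶ Y) (p' : Z ⟶ Y')
    (hid : p ≫ i + p' ≫ i' = 𝟙 Z) : IsInAdd X Z := by
  let F : ULift.{v} Bool → B := fun b => if b.down then Y else Y'
  have : ∀ b, IsInAdd X (F b)
    | ⟨true⟩ => h
    | ⟨false⟩ => h'
  refine (IsInAdd.coproduct this (coproductIsCoproduct F)).of_isRetractOf
    ⟨p ≫ Limits.Sigma.ι F ⟨true⟩ + p' ≫ Limits.Sigma.ι F ⟨false⟩,
      Limits.Sigma.desc fun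
        | ⟨true⟩ => i
        | ⟨false⟩ => i', ?_⟩
  rw [← hid, Preadditive.add_comp]
  refine congrArg₂ _ ?_ ?_
  · exact (Category.assoc _ _ _).trans (congrArg _ (Limits.Sigma.ι_desc _ _))
  · exact (Category.assoc _ _ _).trans (congrArg _ (Limits.Sigma.ι_desc _ _))

end AddClosure

section HomotopyCategory

variable {B : Type u} [Category.{v} B] [Preadditive B] [HasZeroObject B] [HasBinaryBiproducts B]

open Pretriangulated ZeroObject

lemma isLocalizing_isInAdd [HasCoproducts.{v} B] (X : B) :
    IsLocalizing (HomotopyCategory B (ComplexShape.up ℤ))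
      {Z | ∃ W : CochainComplex B ℤ, (∀ n, IsInAdd X (W.X n)) ∧ Nonempty (Z ≅ (toK B).obj W)} where
  zero := by
    refine ⟨0, fun n => (IsInAdd.self X).of_isRetractOf ⟨0, 0, ?_⟩,
      ⟨(isZero_zero _).iso ((toK B).map_isZero (isZero_zero _))⟩⟩
    exact ((HomologicalComplex.eval B (ComplexShape.up ℤ) n).map_isZero (isZero_zero _)).eq_of_src
      _ _
  isoClosed := by
    rintro Y Z e ⟨W, hW, ⟨e'⟩⟩
    exact ⟨W, hW, ⟨e.symm ≪≫ e'⟩⟩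
  shiftClosed := by
    rintro Y n ⟨W, hW, ⟨e⟩⟩
    exact ⟨W⟦n⟧, fun m => hW (m + n),
      ⟨(shiftFunctor _ n).mapIso e ≪≫ (((toK B).commShiftIso n).app W).symm⟩⟩
  ext₂ := by
    rintro D hD ⟨W₁, hW₁, ⟨e₁⟩⟩ ⟨W₃, hW₃, ⟨e₃⟩⟩
    let e₃' : D.invRotate.obj₁ ≅ (toK B).obj (W₃⟦(-1 : ℤ)⟧) :=
      (shiftFunctor _ (-1)).mapIso e₃ ≪≫ (((toK B).commShiftIso (-1)).app W₃).symm
    obtain ⟨f, hf⟩ := (toK B).map_surjective (e₃'.inv ≫ D.invRotate.mor₁ ≫ e₁.hom)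
    let e := isoTriangleOfIso₁₂ D.invRotate (CochainComplex.mappingCone.triangleh f)
      (inv_rot_of_distTriang _ hD) (HomotopyCategory.mappingCone_triangleh_distinguished f) e₃' e₁
      (by
        change D.invRotate.mor₁ ≫ e₁.hom = e₃'.hom ≫ (toK B).map f
        rw [hf, Iso.hom_inv_id_assoc])
    refine ⟨CochainComplex.mappingCone f, fun n => ?_, ⟨Triangle.π₃.mapIso e⟩⟩
    exact (hW₃ (n + 1 + -1)).biprod (hW₁ n) _ _ _ _
      (CochainComplex.mappingCone.id_X f n (n + 1) rfl)
  coproductClosed := by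
    intro I Y hY c hc
    choose W hW e using hY
    obtain ⟨d, ⟨hd⟩⟩ := exists_cofan_complex W
    obtain ⟨hd'⟩ := nonempty_isColimit_toKCofan hd
    refine ⟨d.pt, fun n => IsInAdd.coproduct (fun i => hW i n) (isColimitEvalCofan hd n), ⟨?_⟩⟩
    exact hc.coconePointsIsoOfNatIso hd' (Discrete.natIso fun i => (e i.as).some)

lemma IsWellGenerated.isPureSemisimple [HasCoproducts.{v} B]
    (h : IsWellGenerated (HomotopyCategory B (ComplexShape.up ℤ))) : IsPureSemisimple B := by
  have := hasCoproducts_homotopyCategory (B := B)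
  obtain ⟨κ, -, S, hS⟩ := h
  have := hS.isSmall
  let P (x : Shrink.{v} S × ULift.{v} ℤ) : B := ((equivShrink S).symm x.1).1.as.X x.2.down
  have key := hS.mem_of_isLocalizing (isLocalizing_isInAdd (∐ P)) fun Y hY => by
    refine ⟨Y.as, fun n => (IsInAdd.self _).of_isRetractOf ?_, ⟨Iso.refl _⟩⟩
    obtain ⟨i, hi⟩ := (equivShrink S).symm.surjective ⟨Y, hY⟩
    obtain rfl : ((equivShrink S).symm i).1 = Y := congrArg Subtype.val hi
    classical
    exact ⟨Limits.Sigma.ι P ⟨i, ⟨n⟩⟩, Limits.Sigma.π P ⟨i, ⟨n⟩⟩, Limits.Sigma.ι_π_eq_id _ _⟩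
  refine ⟨∐ P, fun Y => ?_⟩
  obtain ⟨W, hW, ⟨e⟩⟩ := key ((toK B).obj ((HomologicalComplex.single B _ 0).obj Y))
  obtain ⟨f, hf⟩ := (toK B).map_surjective e.hom
  obtain ⟨g, hg⟩ := (toK B).map_surjective e.inv
  have H := HomotopyCategory.homotopyOfEq (f ≫ g) (𝟙 _) (by
    rw [Functor.map_comp, hf, hg, e.hom_inv_id, CategoryTheory.Functor.map_id])
  have h0 : f.f 0 ≫ g.f 0 = 𝟙 _ := by
    have := H.comm 0
    rwa [dNext_eq (i' := 1) _ (by simp), prevD_eq (j' := -1) _ (by simp),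
      HomologicalComplex.single_obj_d, HomologicalComplex.single_obj_d, zero_comp, comp_zero,
      add_zero, zero_add] at this
  let e₀ := HomologicalComplex.singleObjXSelf (ComplexShape.up ℤ) 0 Y
  exact (hW 0).of_isRetractOf ⟨e₀.inv ≫ f.f 0, g.f 0 ≫ e₀.hom, by
    rw [Category.assoc, reassoc_of% h0, Iso.inv_hom_id]⟩

end HomotopyCategory

/-- for a finitely accessible additive category `B`, the following are
equivalent: (1) `K(B)` is well generated; (2) `K(B)` is `ℵ₁`-well generated;
(3) `B` is pure semisimple. If moreover `B` has products, these are further equivalent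
to: (4) `K(B)` is compactly generated. -/
theorem homotopyCategory_wellGenerated_iff_of_finitelyAccessible
    (B : Type u) [Category.{v} B] [Preadditive B] [HasZeroObject B] [HasBinaryBiproducts B]
    (hB : IsFinitelyAccessible B) :
    (IsWellGenerated (HomotopyCategory B (ComplexShape.up ℤ)) ↔
      IsWellGeneratedOfCard (HomotopyCategory B (ComplexShape.up ℤ)) Set.univ
        (Cardinal.aleph 1)) ∧
    (IsWellGenerated (HomotopyCategory B (ComplexShape.up ℤ)) ↔
      IsPureSemisimple.{v} B) ∧
    (HasProducts.{v} B →
      (IsWellGenerated (HomotopyCategory B (ComplexShape.up ℤ)) ↔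
        IsCompactlyGeneratedSubcat (HomotopyCategory B (ComplexShape.up ℤ)) Set.univ)) := by
  have := hB.hasCoproducts
  have h₃₂ (h : IsPureSemisimple.{v} B) := h.isWellGeneratedOfCard_aleph_one hB
  refine ⟨⟨fun h => h₃₂ h.isPureSemisimple, fun h => ⟨_, h⟩⟩,
    ⟨fun h => h.isPureSemisimple, fun h => ⟨_, h₃₂ h⟩⟩, fun _ => ⟨fun h => ?_, fun h => ⟨_, h⟩⟩⟩
  exact IsPureSemisimple.isCompactlyGenerated hB h.isPureSemisimple

end LocWellGen
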